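/- Let n ≥ 4 be a natural number, and suppose that either G = Sym(n) with n even or G = Alt(n) with n odd. Then γ(G) ≥ ((n+1)/2)·(1 − √(1 − 8ζ₂(n))) − ((n+1)/2)·√(8f(n) + ((16n+8)/(n+1)²)·(ζ₂(n) − f(n))). -/

import Mathlib

/-- The normal covering number of a group `G`: the least `s` such that there exist
proper subgroups `H₁, …, H_s` of `G` with every element of `G` lying in some
conjugate of some `Hᵢ`. -/
noncomputable def normalCoveringNumber (G : Type*) [Group G] : ℕ :=
  sInf {s : ℕ | ∃ H : Fin s → Subgroup G, (∀ i, H i ≠ ⊤) ∧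
    ∀ g : G, ∃ i : Fin s, ∃ x : G, x * g * x⁻¹ ∈ H i}

/-- `ζ₂(n) = (1/12) ∏_{p ∣ n, p prime} (1 − 1/p²)`. -/
noncomputable def zeta2 (n : ℕ) : ℝ :=
  (1 / 12) * ∏ p ∈ n.primeFactors, (1 - 1 / (p : ℝ) ^ 2)

/-- The auxiliary function `f(n)` of the paper. -/
noncomputable def fAux (n : ℕ) : ℝ :=
  if Even n then
    (1 / (n : ℝ) ^ 2) * ((Real.logb 3 n + 1) / 4) * ((n - 1).primeFactors.card) +
      2 / (n : ℝ) ^ 2 + 2 / (n : ℝ) ^ ((1 : ℝ) / 2)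
  else
    (1 / (n : ℝ) ^ 2) * ((Real.logb 2 n + 1) / 2) * ((n - 1).primeFactors.card) +
      2 / (n : ℝ) ^ 2 + 2 / (n : ℝ) ^ ((1 : ℝ) / 2)

namespace NormalCovering

open Finset MulAction
open scoped Pointwise

/-- The arithmetic shape of a triple of cycle lengths `a, b, c` coming from a permutation that
preserves a block system with blocks of size `β`, one of which meets exactly the first two
cycles. -/
def IsImprimitiveTriple (a b c : ℕ) : Prop :=
  ∃ β m : ℕ, 1 < β ∧ β < a + b + c ∧ β ∣ a + b + c ∧ m * β = a + b ∧ m ∣ a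

lemma card_block_inter_cycle {α : Type*} [Fintype α] [DecidableEq α]
    {G : Subgroup (Equiv.Perm α)} {g : Equiv.Perm α} (hg : g ∈ G) {A T : Finset α}
    (hA : g.IsCycleOn (A : Set α)) (hT : IsBlock G (T : Set α)) (hTA : (T ∩ A).Nonempty) :
    #(T ∩ A) * period (⟨g, hg⟩ : G) (T : Set α) = #A := by
  obtain ⟨p, hp⟩ := hTA
  rw [mem_inter] at hp
  obtain ⟨hpT, hpA⟩ := hp
  set γ : G := ⟨g, hg⟩ with hγ
  set r := period γ (T : Set α) with hr
  have key : ∀ i : ℕ, (g ^ i) p ∈ T ↔ r ∣ i := by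
    intro i
    rw [hr, ← pow_smul_eq_iff_period_dvd]
    constructor
    · intro h
      apply (isBlock_iff_smul_eq_of_mem.1 hT) (a := p) (by simpa using hpT)
      simpa [Subgroup.smul_def, hγ] using h
    · intro h
      have : (γ ^ i) • p ∈ (T : Set α) := by
        rw [← h]
        exact Set.smul_mem_smul_set (by simpa using hpT)
      simpa [Subgroup.smul_def, hγ] using this
  have hra : r ∣ #A := by
    rw [← key, hA.pow_card_apply hpA]
    exact hpT
  have himg : T ∩ A = ((range #A).filter (fun i => r ∣ i)).image (fun i => (g ^ i) p) := by
    ext x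
    simp only [mem_inter, mem_image, mem_filter, mem_range]
    constructor
    · rintro ⟨hx, hxA⟩
      obtain ⟨i, hi, rfl⟩ := hA.exists_pow_eq hpA hxA
      exact ⟨i, ⟨hi, (key i).1 hx⟩, rfl⟩
    · rintro ⟨i, ⟨hi, hri⟩, rfl⟩
      refine ⟨(key i).2 hri, ?_⟩
      exact (hA.1.perm_pow i).mapsTo hpA
  have hinj : #(T ∩ A) = #((range #A).filter (fun i => r ∣ i)) := by
    rw [himg, card_image_of_injOn]
    intro i hi j hj hij
    simp only [coe_filter, mem_range, Set.mem_ofPred_eq] at hi hj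
    have := (hA.pow_apply_eq_pow_apply hpA).1 hij
    exact Nat.ModEq.eq_of_lt_of_lt this hi.1 hj.1
  rw [hinj]
  obtain ⟨k, hk⟩ := hra
  have hApos : 0 < #A := card_pos.2 ⟨p, hpA⟩
  have hrpos : 0 < r := Nat.pos_of_ne_zero (by rintro h; rw [h, zero_mul] at hk; omega)
  have : (range #A).filter (fun i => r ∣ i) = (range k).image (fun j => r * j) := by
    ext x
    simp only [mem_filter, mem_range, mem_image]
    constructor
    · rintro ⟨h1, j, rfl⟩
      refine ⟨j, ?_, rfl⟩
      rw [hk] at h1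
      exact lt_of_mul_lt_mul_left h1 (Nat.zero_le _)
    · rintro ⟨j, hj, rfl⟩
      refine ⟨?_, dvd_mul_right _ _⟩
      rw [hk]
      exact Nat.mul_lt_mul_of_pos_left hj hrpos
  rw [this, card_image_of_injective _ (fun i j h => Nat.eq_of_mul_eq_mul_left hrpos h),
    card_range, hk, mul_comm]

lemma imprimitive_or_dvd {α : Type*} [Fintype α] [DecidableEq α]
    {G : Subgroup (Equiv.Perm α)} {g : Equiv.Perm α} (hg : g ∈ G) {A B C T : Finset α}
    (hA : g.IsCycleOn (A : Set α)) (hB : g.IsCycleOn (B : Set α)) (hC : g.IsCycleOn (C : Set α))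
    (hAB : Disjoint A B) (hAC : Disjoint A C) (hBC : Disjoint B C) (hU : A ∪ B ∪ C = univ)
    (hgcd : Nat.gcd (Nat.gcd #A #B) #C = 1)
    (hT : IsBlock G (T : Set α)) (hT1 : 1 < #T) (hTn : #T < Fintype.card α)
    (hTd : #T ∣ Fintype.card α) (hTA : (T ∩ A).Nonempty) :
    IsImprimitiveTriple #A #B #C ∨ IsImprimitiveTriple #A #C #B ∨ #T ∣ #A := by
  have hcard : ∀ S : Finset α, #S = #(S ∩ A) + #(S ∩ B) + #(S ∩ C) := by
    intro S
    rw [← card_union_of_disjoint, ← card_union_of_disjoint, ← inter_union_distrib_left,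
      ← inter_union_distrib_left, hU, inter_univ]
    · rw [← inter_union_distrib_left]
      exact (disjoint_union_left.2 ⟨hAC, hBC⟩).mono inter_subset_right inter_subset_right
    · exact hAB.mono inter_subset_right inter_subset_right
  have hn : Fintype.card α = #A + #B + #C := by
    rw [← card_univ, hcard univ]; simp
  have hTc := hcard T
  have eA := card_block_inter_cycle hg hA hT hTA
  set r := period (⟨g, hg⟩ : G) (T : Set α)
  rw [hn] at hTn hTd
  rcases (T ∩ B).eq_empty_or_nonempty with hTB | hTB
  · rw [hTB, card_empty] at hTc
    rcases (T ∩ C).eq_empty_or_nonempty with hTC | hTC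
    · rw [hTC, card_empty] at hTc
      right; right
      rw [hTc, ← eA]
      simp
    · have eC := card_block_inter_cycle hg hC hT hTC
      right; left
      refine ⟨#T, r, hT1, by omega, by rw [add_right_comm]; exact hTd, ?_, Dvd.intro_left _ eA⟩
      rw [← eA, ← eC, hTc]; ring
  · have eB := card_block_inter_cycle hg hB hT hTB
    rcases (T ∩ C).eq_empty_or_nonempty with hTC | hTC
    · rw [hTC, card_empty] at hTc
      left
      refine ⟨#T, r, hT1, hTn, hTd, ?_, Dvd.intro_left _ eA⟩
      rw [← eA, ← eB, hTc]; ring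
    · have eC := card_block_inter_cycle hg hC hT hTC
      exfalso
      have hr : r ∣ 1 := by
        rw [← hgcd]
        exact Nat.dvd_gcd (Nat.dvd_gcd (Dvd.intro_left _ eA) (Dvd.intro_left _ eB))
          (Dvd.intro_left _ eC)
      have hr1 : r = 1 := Nat.dvd_one.1 hr
      change #(T ∩ A) * r = _ at eA
      change #(T ∩ B) * r = _ at eB
      change #(T ∩ C) * r = _ at eC
      rw [hr1] at eA eB eC
      omega

/-- A transitive imprimitive group containing a permutation with three cycles of coprime lengths
forces these lengths to be an imprimitive triple. -/
lemma isPreprimitive_of_three_cycles {α : Type*} [Fintype α] [DecidableEq α]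
    {G : Subgroup (Equiv.Perm α)} [IsPretransitive G α] {g : Equiv.Perm α} (hg : g ∈ G)
    {A B C : Finset α}
    (hA : g.IsCycleOn (A : Set α)) (hB : g.IsCycleOn (B : Set α)) (hC : g.IsCycleOn (C : Set α))
    (hAB : Disjoint A B) (hAC : Disjoint A C) (hBC : Disjoint B C) (hU : A ∪ B ∪ C = univ)
    (hA0 : A.Nonempty) (hB0 : B.Nonempty) (hC0 : C.Nonempty)
    (hgcd : Nat.gcd (Nat.gcd #A #B) #C = 1)
    (h1 : ¬ IsImprimitiveTriple #A #B #C) (h2 : ¬ IsImprimitiveTriple #A #C #B)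
    (h3 : ¬ IsImprimitiveTriple #B #C #A) : IsPreprimitive G α := by
  refine ⟨fun {S} hS => ?_⟩
  by_contra hnt
  rw [IsTrivialBlock, not_or, Set.not_subsingleton_iff] at hnt
  obtain ⟨hS1, hSu⟩ := hnt
  obtain ⟨p, hp⟩ := hS1.nonempty
  have hsymm : ∀ {a b c : ℕ}, IsImprimitiveTriple a b c → IsImprimitiveTriple b a c := by
    rintro a b c ⟨β, m, h1, h2, h3, h4, h5⟩
    refine ⟨β, m, h1, by omega, by rwa [add_comm b a], by omega, ?_⟩
    exact (Nat.dvd_add_right h5).1 ⟨β, h4.symm⟩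
  have hdvd : ∀ {A B C : Finset α}, g.IsCycleOn (A : Set α) → g.IsCycleOn (B : Set α) →
      g.IsCycleOn (C : Set α) → Disjoint A B → Disjoint A C → Disjoint B C →
      A ∪ B ∪ C = univ → A.Nonempty → Nat.gcd (Nat.gcd #A #B) #C = 1 →
      ¬ IsImprimitiveTriple #A #B #C → ¬ IsImprimitiveTriple #A #C #B → S.ncard ∣ #A := by
    intro A B C hA hB hC hAB hAC hBC hU ⟨q, hq⟩ hgcd h1 h2
    obtain ⟨σ, hσ⟩ := exists_smul_eq G p q
    have hT := hS.translate σ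
    have hTc : (σ • S).ncard = S.ncard := Set.ncard_smul_set σ S
    set T : Finset α := (σ • S).toFinite.toFinset with hTdef
    have hTS : (T : Set α) = σ • S := by simp [T]
    have hTcard : #T = S.ncard := by rw [← hTc, ← hTS, Set.ncard_coe_finset]
    rw [← hTS] at hT
    have hqT : q ∈ (T : Set α) := by
      rw [hTS, ← hσ]
      exact Set.smul_mem_smul_set hp
    have := imprimitive_or_dvd hg hA hB hC hAB hAC hBC hU hgcd hT
      (by rw [hTcard]; exact (Set.one_lt_ncard_iff_nontrivial).2 hS1)
      (by rw [hTcard, ← Nat.card_eq_fintype_card]; exact Set.ncard_lt_card hSu)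
      (by rw [hTcard, ← Nat.card_eq_fintype_card]; exact hS.ncard_dvd_card hS1.nonempty)
      ⟨q, mem_inter.2 ⟨by simpa using hqT, hq⟩⟩
    rw [hTcard] at this
    tauto
  have dA := hdvd hA hB hC hAB hAC hBC hU hA0 hgcd h1 h2
  have dB := hdvd hB hA hC hAB.symm hBC hAC (by rw [← hU, union_comm B A]) hB0
    (by rw [← hgcd, Nat.gcd_comm #B #A]) (fun h => h1 (hsymm h)) h3
  have dC := hdvd hC hA hB hAC.symm hBC.symm hAB
    (by rw [← hU, union_assoc, union_comm]) hC0
    (by rw [← hgcd, Nat.gcd_comm #C #A, Nat.gcd_assoc, Nat.gcd_comm #C #B, Nat.gcd_assoc])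
    (fun h => h2 (hsymm h)) (fun h => h3 (hsymm h))
  have := Nat.dvd_gcd (Nat.dvd_gcd dA dB) dC
  rw [hgcd, Nat.dvd_one] at this
  have h4 := (Set.one_lt_ncard_iff_nontrivial).2 hS1
  omega

/-- A permutation group is set-homogeneous on pairs if it is transitive on unordered pairs. -/
def IsPairHomogeneous {α : Type*} (G : Subgroup (Equiv.Perm α)) : Prop :=
  ∀ ⦃x y x' y' : α⦄, x ≠ y → x' ≠ y' →
    ∃ σ ∈ G, (σ x = x' ∧ σ y = y') ∨ (σ x = y' ∧ σ y = x')

lemma card_support_commutator_le {α : Type*} [Fintype α] [DecidableEq α] (h k : Equiv.Perm α) :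
    #(h * k * h⁻¹ * k⁻¹).support ≤ 3 * #(h.support ∩ k.support) := by
  set T := h.support ∩ k.support with hT
  have hsub : (h * k * h⁻¹ * k⁻¹).support ⊆ T ∪ T.image h ∪ T.image k := by
    intro x hx
    by_contra hn
    simp only [mem_union, mem_image, not_or, not_exists, not_and] at hn
    obtain ⟨⟨h1, h2⟩, h3⟩ := hn
    have h2' : h⁻¹ x ∉ T := fun h => h2 _ h (by simp)
    have h3' : k⁻¹ x ∉ T := fun h => h3 _ h (by simp)
    have hmove : ∀ f : Equiv.Perm α, f x ≠ x → f (f⁻¹ x) ≠ f⁻¹ x := by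
      intro f hf h
      rw [← Equiv.Perm.mul_apply, mul_inv_cancel, Equiv.Perm.one_apply] at h
      exact hf (Equiv.Perm.inv_eq_iff_eq.1 h.symm).symm
    rw [Equiv.Perm.mem_support] at hx
    apply hx
    simp only [hT, mem_inter, not_and, Equiv.Perm.mem_support, not_not] at h1 h2' h3'
    simp only [Equiv.Perm.coe_mul, Function.comp_apply]
    by_cases hh : h x = x
    · by_cases hk : k x = x
      · have e1 : k⁻¹ x = x := by rw [Equiv.Perm.inv_eq_iff_eq, hk]
        have e2 : h⁻¹ x = x := by rw [Equiv.Perm.inv_eq_iff_eq, hh]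
        rw [e1, e2, hk, hh]
      · have hkx : k (k⁻¹ x) ≠ k⁻¹ x := hmove k hk
        have e : h (k⁻¹ x) = k⁻¹ x := by
          by_contra hc; exact hkx (h3' hc)
        have e' : h⁻¹ (k⁻¹ x) = k⁻¹ x := by rw [Equiv.Perm.inv_eq_iff_eq, e]
        rw [e']; simp [hh]
    · have hk := h1 hh
      have e1 : k⁻¹ x = x := by rw [Equiv.Perm.inv_eq_iff_eq, hk]
      have hhx : h (h⁻¹ x) ≠ h⁻¹ x := hmove h hh
      rw [e1, h2' hhx]; simp
  calc _ ≤ #(T ∪ T.image h ∪ T.image k) := card_le_card hsub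
    _ ≤ #T + #(T.image h) + #(T.image k) :=
        (card_union_le _ _).trans (Nat.add_le_add_right (card_union_le _ _) _)
    _ ≤ _ := by
        have := card_image_le (s := T) (f := h)
        have := card_image_le (s := T) (f := k)
        omega

section Moments

variable {α : Type*} [Fintype α] [DecidableEq α] (G : Subgroup (Equiv.Perm α)) [Fintype G]

/-- The number of elements of `G` moving both `u` and `v` into `M`. -/
def pairCount (M : Finset α) (u v : α) : ℕ :=
  #{σ : G | (σ : Equiv.Perm α) u ∈ M ∧ (σ : Equiv.Perm α) v ∈ M}

variable {G}

omit [Fintype α] in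
lemma pairCount_smul (M : Finset α) (u v : α) {τ : Equiv.Perm α} (hτ : τ ∈ G) :
    pairCount G M (τ u) (τ v) = pairCount G M u v := by
  refine card_bij (fun σ _ => σ * ⟨τ, hτ⟩) ?_ ?_ ?_
  · intro σ hσ; simpa using hσ
  · intro σ _ σ' _ h; simpa using h
  · intro σ hσ
    refine ⟨σ * ⟨τ, hτ⟩⁻¹, ?_, by simp⟩
    simpa using hσ

omit [Fintype α] in
lemma pairCount_comm (M : Finset α) (u v : α) : pairCount G M u v = pairCount G M v u := by
  unfold pairCount; congr 1; ext σ; simp [and_comm]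

omit [Fintype α] in
lemma sum_pairCount (M P Q : Finset α) :
    ∑ u ∈ P, ∑ v ∈ Q, pairCount G M u v =
      ∑ σ : G, #{u ∈ P | (σ : Equiv.Perm α) u ∈ M} * #{v ∈ Q | (σ : Equiv.Perm α) v ∈ M} := by
  simp only [pairCount, card_filter]
  simp_rw [sum_comm (s := Q), sum_comm (s := P) (t := (univ : Finset G)), sum_mul_sum]
  refine sum_congr rfl fun σ _ => sum_congr rfl fun u _ => sum_congr rfl fun v _ => ?_
  by_cases h1 : (σ : Equiv.Perm α) u ∈ M <;> by_cases h2 : (σ : Equiv.Perm α) v ∈ M <;>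
    simp [h1, h2]

lemma card_filter_perm_mem (σ : Equiv.Perm α) (M : Finset α) : #{u | σ u ∈ M} = #M := by
  refine card_bij (fun u _ => σ u) ?_ ?_ ?_
  · intro u hu; simpa using hu
  · intro u _ v _ h; simpa using h
  · intro v hv; exact ⟨σ⁻¹ v, by simpa using hv, by simp⟩

lemma card_mul_pairCount_self [IsPretransitive G α] (M : Finset α) (u : α) :
    Fintype.card α * pairCount G M u u = Fintype.card G * #M := by
  have hconst : ∀ v, pairCount G M v v = pairCount G M u u := by
    intro v
    obtain ⟨σ, hσ⟩ := exists_smul_eq G u v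
    rw [← hσ]
    exact pairCount_smul M u u σ.2
  calc _ = ∑ v : α, pairCount G M v v := by
        rw [sum_congr rfl fun v _ => hconst v]; simp
    _ = ∑ σ : G, #{v : α | (σ : Equiv.Perm α) v ∈ M} := by
        simp only [pairCount, card_filter, and_self]
        rw [sum_comm]
    _ = _ := by simp [card_filter_perm_mem]

lemma card_mul_pairCount_of_ne [IsPretransitive G α] (hG : IsPairHomogeneous G) (M : Finset α)
    {u v : α} (huv : u ≠ v) :
    (Fintype.card α : ℝ) * (Fintype.card α - 1) * pairCount G M u v =
      Fintype.card G * (#M * (#M - 1)) := by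
  have hconst : ∀ x y, x ≠ y → pairCount G M x y = pairCount G M u v := by
    intro x y hxy
    obtain ⟨σ, hσ, ⟨rfl, rfl⟩ | ⟨rfl, rfl⟩⟩ := hG huv hxy
    · exact pairCount_smul M u v hσ
    · rw [pairCount_comm]; exact pairCount_smul M u v hσ
  have h1 : ∑ x : α, ∑ y : α, (pairCount G M x y : ℝ) = Fintype.card G * (#M * #M) := by
    have := sum_pairCount (G := G) M univ univ
    simp only [card_filter_perm_mem, sum_const, card_univ, smul_eq_mul] at this
    exact_mod_cast this
  have h2 : ∀ x : α, ∑ y : α, (pairCount G M x y : ℝ) =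
      pairCount G M u u + (Fintype.card α - 1) * pairCount G M u v := by
    intro x
    rw [← add_sum_erase _ _ (mem_univ x), sum_congr rfl (g := fun _ => (pairCount G M u v : ℝ))
      (fun y hy => by rw [hconst x y (ne_of_mem_erase hy).symm])]
    have hx : pairCount G M x x = pairCount G M u u := by
      obtain ⟨σ, hσ⟩ := exists_smul_eq G u x
      rw [← hσ]
      exact pairCount_smul M u u σ.2
    have hpos : 1 ≤ Fintype.card α := Fintype.card_pos_iff.2 ⟨u⟩
    rw [hx, sum_const, card_erase_of_mem (mem_univ x), card_univ, nsmul_eq_mul]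
    push_cast [hpos]
    ring
  rw [sum_congr rfl fun x _ => h2 x, sum_const, card_univ, nsmul_eq_mul, mul_add] at h1
  have h3 : (Fintype.card α : ℝ) * pairCount G M u u = Fintype.card G * #M := by
    exact_mod_cast card_mul_pairCount_self M u
  rw [h3] at h1
  linear_combination h1

lemma mul_sq_le_of_minimal_support [IsPretransitive G α] (hG : IsPairHomogeneous G)
    {h : Equiv.Perm α} (hh : h ∈ G) (hmin : ∀ k ∈ G, k ≠ 1 → #h.support ≤ #k.support)
    (hn : 2 ≤ Fintype.card α) (hm0 : 1 ≤ #h.support) (hm : 3 * #h.support < Fintype.card α) :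
    (#h.support : ℝ) * (Fintype.card α - 3 * #h.support) ^ 2 ≤
      3 * Fintype.card α * (Fintype.card α - #h.support) := by
  set M := h.support with hM
  set n : ℝ := ((Fintype.card α : ℕ) : ℝ) with hnd
  set m : ℝ := ((#M : ℕ) : ℝ) with hmd
  set N : ℝ := ((Fintype.card G : ℕ) : ℝ) with hN
  have hn' : (2 : ℝ) ≤ n := by rw [hnd]; exact_mod_cast hn
  have hm0' : (1 : ℝ) ≤ m := by rw [hmd]; exact_mod_cast hm0
  have hm' : 3 * m < n := by rw [hmd, hnd]; exact_mod_cast hm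
  have hNpos : 0 < N := by rw [hN]; exact_mod_cast Fintype.card_pos
  set t : G → ℝ := fun σ => #{u ∈ M | (σ : Equiv.Perm α) u ∈ M} with ht
  set s : G → ℝ := fun σ => #{u ∈ M | (σ : Equiv.Perm α) u ∈ M ∧ (σ : Equiv.Perm α) (h u) ∉ M}
    with hs
  have hpos : 0 < n := by linarith
  have F1 : ∀ u, (pairCount G M u u : ℝ) = N * m / n := by
    intro u
    have := card_mul_pairCount_self (G := G) M u
    rw [eq_div_iff hpos.ne', hN, hmd, hnd]
    rw [mul_comm]
    exact_mod_cast this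
  have F2 : ∀ u v, u ≠ v → (pairCount G M u v : ℝ) = N * (m * (m - 1)) / (n * (n - 1)) := by
    intro u v huv
    rw [eq_div_iff (by nlinarith), mul_comm]
    exact card_mul_pairCount_of_ne hG M huv
  have St : ∑ σ, t σ = N * m ^ 2 / n := by
    have : ∑ σ, t σ = ∑ u ∈ M, (pairCount G M u u : ℝ) := by
      simp only [ht, pairCount, card_filter, and_self]
      push_cast
      rw [sum_comm]
    rw [this, sum_congr rfl fun u _ => F1 u, sum_const, nsmul_eq_mul]
    ring
  have St2 : ∑ σ, t σ ^ 2 = N * m ^ 2 / n + N * (m * (m - 1)) ^ 2 / (n * (n - 1)) := by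
    have e1 : ∑ σ, t σ ^ 2 = ∑ u ∈ M, ∑ v ∈ M, (pairCount G M u v : ℝ) := by
      have := sum_pairCount (G := G) M M M
      rw [ht]
      simp_rw [sq]
      exact_mod_cast this.symm
    have e2 : ∀ u ∈ M, ∑ v ∈ M, (pairCount G M u v : ℝ) =
        N * m / n + (m - 1) * (N * (m * (m - 1)) / (n * (n - 1))) := by
      intro u hu
      rw [← add_sum_erase _ _ hu, F1 u, sum_congr rfl fun v hv => F2 u v (ne_of_mem_erase hv).symm,
        sum_const, card_erase_of_mem hu, nsmul_eq_mul, Nat.cast_sub hm0]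
      simp [hmd]
    rw [e1, sum_congr rfl e2, sum_const, nsmul_eq_mul]
    ring
  have Ss : ∑ σ, s σ = N * m ^ 2 / n - m * (N * (m * (m - 1)) / (n * (n - 1))) := by
    have e1 : ∀ σ, s σ = t σ -
        #{u ∈ M | (σ : Equiv.Perm α) u ∈ M ∧ (σ : Equiv.Perm α) (h u) ∈ M} := by
      intro σ
      rw [eq_sub_iff_add_eq]
      simp only [hs, ht]
      norm_cast
      rw [← filter_filter, ← filter_filter, add_comm, card_filter_add_card_filter_not]
    have e2 : ∑ σ : G, (#{u ∈ M | (σ : Equiv.Perm α) u ∈ M ∧ (σ : Equiv.Perm α) (h u) ∈ M} : ℝ) =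
        ∑ u ∈ M, (pairCount G M u (h u) : ℝ) := by
      simp only [pairCount, card_filter]
      push_cast
      rw [sum_comm]
    rw [sum_congr rfl fun σ _ => e1 σ, sum_sub_distrib, e2, St,
      sum_congr rfl fun u hu => F2 u (h u) (Equiv.Perm.mem_support.1 hu).symm,
      sum_const, nsmul_eq_mul]
  have hpt : ∀ σ, s σ * (m / 3 - m ^ 2 / n) ^ 2 ≤ m / 3 * (t σ - m ^ 2 / n) ^ 2 := by
    intro σ
    have hst : s σ ≤ t σ := by
      simp only [hs, ht]
      exact_mod_cast card_le_card fun u => by simp +contextual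
    rcases ({u ∈ M | (σ : Equiv.Perm α) u ∈ M ∧ (σ : Equiv.Perm α) (h u) ∉ M} :
      Finset α).eq_empty_or_nonempty with h0 | ⟨u, hu⟩
    · have : s σ = 0 := by simp [hs, h0]
      rw [this, zero_mul]
      positivity
    · simp only [mem_filter] at hu
      obtain ⟨hu1, hu2, hu3⟩ := hu
      set k : Equiv.Perm α := (σ : Equiv.Perm α)⁻¹ * h * σ with hk
      have hkG : k ∈ G := G.mul_mem (G.mul_mem (G.inv_mem σ.2) hh) σ.2
      have hks : ∀ x, x ∈ k.support ↔ (σ : Equiv.Perm α) x ∈ M := by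
        intro x
        rw [hM, Equiv.Perm.mem_support, Equiv.Perm.mem_support, hk]
        simp [Equiv.symm_apply_eq]
      have hne : h * k * h⁻¹ * k⁻¹ ≠ 1 := by
        intro hc
        have hcomm : h * k = k * h := by
          rw [mul_inv_eq_one, mul_inv_eq_iff_eq_mul] at hc
          exact hc
        have h1 : k (h u) = h u := by
          by_contra hne
          exact hu3 ((hks _).1 (Equiv.Perm.mem_support.2 hne))
        have h2 : h (k u) = k (h u) := by
          rw [← Equiv.Perm.mul_apply, hcomm, Equiv.Perm.mul_apply]
        rw [h1] at h2
        exact Equiv.Perm.mem_support.1 ((hks u).2 hu2) (h.injective h2)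
      have hge := (hmin _ (G.mul_mem (G.mul_mem (G.mul_mem hh hkG) (G.inv_mem hh))
        (G.inv_mem hkG)) hne).trans (card_support_commutator_le h k)
      have hT : h.support ∩ k.support = {u ∈ M | (σ : Equiv.Perm α) u ∈ M} := by
        ext x
        rw [mem_inter, mem_filter, hks]
      have hge' : m ≤ 3 * t σ := by
        rw [hT] at hge
        simp only [ht, hmd]
        exact_mod_cast hge
      have hτ : m ^ 2 / n ≤ m / 3 := by
        rw [div_le_div_iff₀ hpos (by norm_num)]
        nlinarith
      have hτ0 : 0 ≤ m ^ 2 / n := by positivity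
      set τ := m ^ 2 / n
      have h1 : (m / 3) ≤ t σ := by linarith
      have h2 : τ ^ 2 ≤ m / 3 * t σ := by nlinarith
      nlinarith [mul_nonneg (sub_nonneg.2 h1) (sub_nonneg.2 h2),
        mul_le_mul_of_nonneg_right hst (sq_nonneg (m / 3 - τ))]
  have hsum := sum_le_sum fun σ (_ : σ ∈ (univ : Finset G)) => hpt σ
  rw [← sum_mul, ← mul_sum] at hsum
  have hvar : ∑ σ, (t σ - m ^ 2 / n) ^ 2 = N * (m ^ 2 * (n - m) ^ 2 / (n ^ 2 * (n - 1))) := by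
    have : ∀ σ, (t σ - m ^ 2 / n) ^ 2 =
        t σ ^ 2 - 2 * (m ^ 2 / n) * t σ + (m ^ 2 / n) ^ 2 := fun σ => by ring
    rw [sum_congr rfl fun σ _ => this σ, sum_add_distrib, sum_sub_distrib, ← mul_sum, St, St2,
      sum_const, card_univ, nsmul_eq_mul, ← hN]
    have : n - 1 ≠ 0 := by linarith
    field_simp
    ring
  rw [hvar, Ss] at hsum
  have hn1 : 0 < n - 1 := by linarith
  have hl : (N * m ^ 2 / n - m * (N * (m * (m - 1)) / (n * (n - 1)))) * (m / 3 - m ^ 2 / n) ^ 2 =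
      N * m ^ 3 * (n - m) / (9 * n ^ 3 * (n - 1)) * (m * (n - 3 * m) ^ 2) := by
    field_simp
    ring
  have hr : m / 3 * (N * (m ^ 2 * (n - m) ^ 2 / (n ^ 2 * (n - 1)))) =
      N * m ^ 3 * (n - m) / (9 * n ^ 3 * (n - 1)) * (3 * n * (n - m)) := by
    field_simp
    ring
  rw [hl, hr] at hsum
  refine le_of_mul_le_mul_left hsum ?_
  have : 0 < n - m := by linarith
  positivity

end Moments

/-- A proper pair-homogeneous primitive group of large degree contains no nontrivial element of
small support. -/
theorem not_small_support_of_isPairHomogeneous {α : Type*} [Fintype α] [DecidableEq α]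
    {G : Subgroup (Equiv.Perm α)} [IsPreprimitive G α] (hG : IsPairHomogeneous G)
    (hA : ¬ alternatingGroup α ≤ G) (hn : 300 ≤ Fintype.card α) {h : Equiv.Perm α} (hh : h ∈ G)
    (h1 : h ≠ 1) (h3 : 3 * #h.support < Fintype.card α) :
    ((Fintype.card α : ℝ) - 3 * #h.support) ^ 2 < 16 * Fintype.card α := by
  classical
  by_contra! hc
  obtain ⟨k, hk, hkmin⟩ := exists_min_image
    ({k | k ∈ G ∧ k ≠ 1} : Finset (Equiv.Perm α)) (fun k => #k.support)
    ⟨h, by simp [hh, h1]⟩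
  simp only [mem_filter, mem_univ, true_and] at hk hkmin
  obtain ⟨hkG, hk1⟩ := hk
  have hkh := hkmin h ⟨hh, h1⟩
  have hk2 : 4 ≤ #k.support := by
    by_contra! hlt
    have h0 : #k.support ≠ 0 := by rwa [Ne, Equiv.Perm.card_support_eq_zero]
    have h1 : #k.support ≠ 1 := Equiv.Perm.card_support_ne_one k
    obtain h2 | h3 : #k.support = 2 ∨ #k.support = 3 := by omega
    · apply hA
      rw [Equiv.Perm.subgroup_eq_top_of_isPreprimitive_of_isSwap_mem ‹_› k
        (Equiv.Perm.card_support_eq_two.1 h2) hkG]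
      exact le_top
    · exact hA (Equiv.Perm.alternatingGroup_le_of_isPreprimitive_of_isThreeCycle_mem ‹_›
        (card_support_eq_three_iff.1 h3) hkG)
  have key := mul_sq_le_of_minimal_support hG hkG (fun σ hσ h => hkmin σ ⟨hσ, h⟩) (by omega)
    (by omega) (by omega)
  set m : ℝ := ((#k.support : ℕ) : ℝ) with hm
  set m' : ℝ := ((#h.support : ℕ) : ℝ) with hm'
  set n : ℝ := ((Fintype.card α : ℕ) : ℝ) with hnd
  have e1 : (4 : ℝ) ≤ m := by rw [hm]; exact_mod_cast hk2
  have e2 : m ≤ m' := by rw [hm, hm']; exact_mod_cast hkh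
  have e3 : 3 * m' < n := by rw [hm', hnd]; exact_mod_cast h3
  have e4 : (300 : ℝ) ≤ n := by rw [hnd]; exact_mod_cast hn
  have e5 : 16 * n ≤ (n - 3 * m) ^ 2 := by nlinarith
  rcases le_total n (6 * m) with h6 | h6
  · nlinarith
  rcases le_total m 12 with h12 | h12
  · have : (n - 36) ^ 2 ≤ (n - 3 * m) ^ 2 := by nlinarith
    nlinarith
  · have : (n / 2) ^ 2 ≤ (n - 3 * m) ^ 2 := by nlinarith
    nlinarith

/-- A space of real functions stable under precomposition with the elements of `G`. -/
def IsInvariantSpace {α : Type*} (G : Subgroup (Equiv.Perm α)) (W : Submodule ℝ (α → ℝ)) : Prop :=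
  ∀ σ ∈ G, ∀ f ∈ W, f ∘ σ ∈ W

lemma eq_top_of_invariant_of_mul_mem {α : Type*} [Finite α] {G : Subgroup (Equiv.Perm α)}
    [IsPreprimitive G α] {U : Submodule ℝ (α → ℝ)} (hU : IsInvariantSpace G U) (h1 : 1 ∈ U)
    (hmul : ∀ f g, f ∈ U → g ∈ U → f * g ∈ U) {φ : α → ℝ} (hφ : φ ∈ U) {x y : α}
    (hxy : φ x ≠ φ y) : U = ⊤ := by
  classical
  have := Fintype.ofFinite α
  have hsep : ∀ a b, a ≠ b → ∃ ψ ∈ U, ψ a ≠ ψ b := by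
    intro a b hab
    obtain ⟨σ, hσa, hσb⟩ := IsPreprimitive.exists_mem_smul_and_notMem_smul (G := G)
      (A := {z | φ z = φ x}) (Set.toFinite _) ⟨x, rfl⟩
      (fun h => hxy (by
        have : y ∈ {z | φ z = φ x} := by rw [h]; trivial
        exact this.symm)) hab
    rw [Set.mem_smul_set_iff_inv_smul_mem] at hσa hσb
    refine ⟨φ ∘ ((σ⁻¹ : G) : Equiv.Perm α), hU _ (σ⁻¹).2 φ hφ, fun h => hσb ?_⟩
    exact h.symm.trans hσa
  have hconst : ∀ c : ℝ, (fun _ => c) ∈ U := by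
    intro c
    convert U.smul_mem c h1 using 1
    ext; simp
  let S : Subalgebra ℝ (α → ℝ) := U.toSubalgebra h1 hmul
  have hsingle : ∀ a, Pi.single a (1 : ℝ) ∈ U := by
    intro a
    have : ∀ b, ∃ χ ∈ S, χ a = 1 ∧ (b ≠ a → χ b = 0) := by
      intro b
      by_cases hab : b = a
      · exact ⟨1, h1, rfl, fun h => absurd hab h⟩
      · obtain ⟨ψ, hψ, hne⟩ := hsep a b (Ne.symm hab)
        refine ⟨(ψ a - ψ b)⁻¹ • (ψ - fun _ => ψ b), U.smul_mem _ (U.sub_mem hψ (hconst _)), ?_, ?_⟩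
        · simp [sub_ne_zero.2 hne]
        · simp
    choose χ hχ hχa hχb using this
    have hprod : ∏ b, χ b ∈ S := prod_mem fun b _ => hχ b
    convert (show ∏ b, χ b ∈ U from hprod) using 1
    ext b
    rw [Finset.prod_apply]
    by_cases hab : b = a
    · subst hab
      simp [hχa]
    · rw [Pi.single_eq_of_ne hab, eq_comm]
      exact prod_eq_zero (mem_univ b) (hχb b hab)
  rw [eq_top_iff]
  intro f _
  rw [pi_eq_sum_univ' f]
  exact U.sum_mem fun a _ => by
    convert U.smul_mem (f a) (hsingle a) using 2

lemma exists_invariant_mul_span {α : Type*} [Finite α] {G : Subgroup (Equiv.Perm α)}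
    {U : Submodule ℝ (α → ℝ)} (hU : IsInvariantSpace G U) (h1 : 1 ∈ U) :
    ∃ U' : Submodule ℝ (α → ℝ), IsInvariantSpace G U' ∧ U ≤ U' ∧
      (∀ f g, f ∈ U → g ∈ U → f * g ∈ U') ∧
      Module.finrank ℝ U' ≤ (Module.finrank ℝ U + 1).choose 2 := by
  classical
  have := Fintype.ofFinite α
  let b := Module.finBasis ℝ U
  let k := Module.finrank ℝ U
  let F : Sym2 (Fin k) → (α → ℝ) :=
    Sym2.lift ⟨fun i j => (b i : α → ℝ) * b j, fun i j => mul_comm _ _⟩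
  have hmul : ∀ f g, f ∈ U → g ∈ U → f * g ∈ Submodule.span ℝ (Set.range F) := by
    intro f g hf hg
    have ef : f = ∑ i, b.repr ⟨f, hf⟩ i • (b i : α → ℝ) := by
      conv_lhs => rw [← Subtype.coe_mk f hf, ← b.sum_repr ⟨f, hf⟩]
      rw [Submodule.coe_sum]
      rfl
    have eg : g = ∑ i, b.repr ⟨g, hg⟩ i • (b i : α → ℝ) := by
      conv_lhs => rw [← Subtype.coe_mk g hg, ← b.sum_repr ⟨g, hg⟩]
      rw [Submodule.coe_sum]
      rfl
    rw [ef, eg, sum_mul_sum]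
    refine Submodule.sum_mem _ fun i _ => Submodule.sum_mem _ fun j _ => ?_
    rw [smul_mul_smul_comm]
    exact Submodule.smul_mem _ _ (Submodule.subset_span ⟨s(i, j), rfl⟩)
  refine ⟨Submodule.span ℝ (Set.range F), ?_, ?_, hmul, ?_⟩
  · intro σ hσ f hf
    induction hf using Submodule.span_induction with
    | mem f hf =>
      obtain ⟨z, rfl⟩ := hf
      induction z with
      | _ i j => exact hmul _ _ (hU σ hσ _ (b i).2) (hU σ hσ _ (b j).2)
    | zero => exact Submodule.zero_mem _
    | add f g _ _ hf hg => exact Submodule.add_mem _ hf hg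
    | smul c f _ hf => exact Submodule.smul_mem _ c hf
  · intro f hf
    simpa using hmul f 1 hf h1
  · refine (finrank_range_le_card F).trans ?_
    rw [Sym2.card]
    simp [k]

lemma not_invariant_of_gap {α : Type*} [Fintype α] {G : Subgroup (Equiv.Perm α)}
    [IsPreprimitive G α] {K : ℕ} (hK : (K + 1).choose 2 + K < Fintype.card α)
    (hgap : ∀ W, IsInvariantSpace G W →
      Module.finrank ℝ W ≤ K ∨ Fintype.card α ≤ Module.finrank ℝ W + K)
    {U : Submodule ℝ (α → ℝ)} (hU : IsInvariantSpace G U) (h1 : 1 ∈ U)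
    (hUK : Module.finrank ℝ U ≤ K) {φ : α → ℝ} (hφ : φ ∈ U) {x y : α}
    (hxy : φ x ≠ φ y) : False := by
  induction hd : K - Module.finrank ℝ U using Nat.strong_induction_on generalizing U with
  | _ d ih =>
    obtain ⟨U', hU', hle, hmul, hfin⟩ := exists_invariant_mul_span hU h1
    have hch : (Module.finrank ℝ U + 1).choose 2 ≤ (K + 1).choose 2 :=
      Nat.choose_le_choose 2 (by omega)
    have hU'K : Module.finrank ℝ U' ≤ K := by
      rcases hgap U' hU' with h | h
      · exact h
      · omega
    by_cases hlt : Module.finrank ℝ U < Module.finrank ℝ U'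
    · exact ih (K - Module.finrank ℝ U') (by omega) hU' (hle h1) hU'K (hle hφ) rfl
    · have heq : U = U' := Submodule.eq_of_le_of_finrank_le hle (not_lt.1 hlt)
      have htop := eq_top_of_invariant_of_mul_mem hU h1
        (fun f g hf hg => by rw [heq]; exact hmul f g hf hg) hφ hxy
      rw [htop, finrank_top, Module.finrank_fintype_fun_eq_card] at hUK
      omega

/-- If the dimension of every invariant space of functions is either at most `K` or at least
`n - K`, with `K` smaller than about `√(2n)`, then a primitive group is pair-homogeneous. -/
theorem isPairHomogeneous_of_gap {α : Type*} [Fintype α] {G : Subgroup (Equiv.Perm α)}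
    [IsPreprimitive G α] {K : ℕ} (hK : (K + 1).choose 2 + K < Fintype.card α)
    (hK1 : 2 * K + 1 < Fintype.card α)
    (hgap : ∀ W, IsInvariantSpace G W →
      Module.finrank ℝ W ≤ K ∨ Fintype.card α ≤ Module.finrank ℝ W + K) :
    IsPairHomogeneous G := by
  classical
  -- no small invariant space contains a non-constant function
  have hsmall : ∀ W, IsInvariantSpace G W → Module.finrank ℝ W ≤ K →
      ∀ φ ∈ W, ∀ x y, φ x = φ y := by
    intro W hW hWK φ hφ x y
    by_contra hxy
    set U := W ⊔ Submodule.span ℝ {(1 : α → ℝ)} with hUdef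
    have hU : IsInvariantSpace G U := by
      intro σ hσ f hf
      obtain ⟨f₁, hf₁, f₂, hf₂, rfl⟩ := Submodule.mem_sup.1 hf
      obtain ⟨c, rfl⟩ := Submodule.mem_span_singleton.1 hf₂
      exact Submodule.add_mem_sup (hW σ hσ f₁ hf₁) (Submodule.mem_span_singleton.2 ⟨c, rfl⟩)
    have hU1 : 1 ∈ U := Submodule.mem_sup_right (Submodule.mem_span_singleton_self _)
    have hUle : Module.finrank ℝ U ≤ K + 1 := by
      refine (Submodule.finrank_add_le_finrank_add_finrank _ _).trans ?_
      have := finrank_span_le_card (R := ℝ) ({(1 : α → ℝ)} : Set (α → ℝ))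
      rw [Set.toFinset_singleton, card_singleton] at this
      omega
    have hUK : Module.finrank ℝ U ≤ K := by
      rcases hgap U hU with h | h <;> omega
    exact not_invariant_of_gap hK hgap hU hU1 hUK (Submodule.mem_sup_left hφ) hxy
  intro x₀ y₀ x₁ y₁ h₀ h₁
  let r : α → α → Prop := fun x y =>
    ∃ σ ∈ G, (σ x₀ = x ∧ σ y₀ = y) ∨ (σ x₀ = y ∧ σ y₀ = x)
  have hr_symm : ∀ x y, r x y → r y x := by
    rintro x y ⟨σ, hσ, h⟩
    exact ⟨σ, hσ, h.symm⟩
  have hr_smul : ∀ τ ∈ G, ∀ x y, r (τ x) (τ y) ↔ r x y := by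
    have : ∀ τ ∈ G, ∀ x y, r x y → r (τ x) (τ y) := by
      rintro τ hτ x y ⟨σ, hσ, h⟩
      refine ⟨τ * σ, G.mul_mem hτ hσ, ?_⟩
      rcases h with ⟨rfl, rfl⟩ | ⟨rfl, rfl⟩ <;> simp
    intro τ hτ x y
    refine ⟨fun h => ?_, this τ hτ x y⟩
    simpa using this τ⁻¹ (G.inv_mem hτ) _ _ h
  have hr_irrefl : ∀ x, ¬ r x x := by
    rintro x ⟨σ, hσ, ⟨h, h'⟩ | ⟨h, h'⟩⟩
    · exact h₀ (σ.injective (h.trans h'.symm))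
    · exact h₀ (σ.injective (h.trans h'.symm))
  change r x₁ y₁
  let A : Matrix α α ℝ := Matrix.of fun x y => if r x y then 1 else 0
  have hAinv : ∀ τ ∈ G, ∀ x y, A (τ x) (τ y) = A x y := by
    intro τ hτ x y
    simp only [A, Matrix.of_apply, hr_smul τ hτ]
  have hAsymm : ∀ x y, A x y = A y x := by
    intro x y
    simp only [A, Matrix.of_apply]
    congr 1
    exact propext ⟨hr_symm x y, hr_symm y x⟩
  have hAcomm : ∀ τ ∈ G, ∀ v : α → ℝ, A.mulVec (v ∘ τ) = A.mulVec v ∘ τ := by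
    intro τ hτ v
    ext x
    simp only [Matrix.mulVec, dotProduct, Function.comp_apply]
    rw [← Equiv.sum_comp τ (fun y => A (τ x) y * v y)]
    exact sum_congr rfl fun y _ => by rw [hAinv τ hτ]
  have hAh : A.IsHermitian := by
    ext x y
    simpa using hAsymm y x
  -- there is a non-constant eigenvector
  obtain ⟨j, hj⟩ : ∃ j, ∃ x y, hAh.eigenvectorBasis j x ≠ hAh.eigenvectorBasis j y := by
    by_contra! hcon
    have hall : ∀ v : EuclideanSpace ℝ α, ∀ x y, v x = v y := by
      intro v x y
      rw [← hAh.eigenvectorBasis.sum_repr v]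
      simp only [WithLp.ofLp_sum, WithLp.ofLp_smul, Finset.sum_apply, Pi.smul_apply]
      exact sum_congr rfl fun j _ => by rw [hcon j x y]
    have := hall (EuclideanSpace.single x₀ 1) x₀ y₀
    simp [h₀.symm] at this
  set μ := hAh.eigenvalues j with hμ
  let L : (α → ℝ) →ₗ[ℝ] (α → ℝ) := Matrix.mulVecLin A - μ • LinearMap.id
  have hLcomm : ∀ τ ∈ G, ∀ v : α → ℝ, L (v ∘ τ) = L v ∘ τ := by
    intro τ hτ v
    simp only [L, LinearMap.sub_apply, Matrix.mulVecLin_apply, hAcomm τ hτ v]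
    rfl
  have hker : IsInvariantSpace G (LinearMap.ker L) := by
    intro σ hσ f hf
    rw [LinearMap.mem_ker] at hf ⊢
    rw [hLcomm σ hσ, hf]
    rfl
  have hran : IsInvariantSpace G (LinearMap.range L) := by
    rintro σ hσ _ ⟨v, rfl⟩
    exact ⟨v ∘ σ, hLcomm σ hσ v⟩
  have hrn := LinearMap.finrank_range_add_finrank_ker L
  rw [Module.finrank_fintype_fun_eq_card] at hrn
  have hker_big : ¬ Module.finrank ℝ (LinearMap.ker L) ≤ K := by
    intro h
    obtain ⟨x, y, hxy⟩ := hj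
    refine hxy (hsmall _ hker h (hAh.eigenvectorBasis j).ofLp ?_ x y)
    rw [LinearMap.mem_ker]
    simp only [L, LinearMap.sub_apply, Matrix.mulVecLin_apply, hAh.mulVec_eigenvectorBasis j]
    simp [hμ]
  have hranK : Module.finrank ℝ (LinearMap.range L) ≤ K := by
    rcases hgap _ hker with h | h
    · exact absurd h hker_big
    · omega
  have hconst := hsmall _ hran hranK
  -- the graph `r` is regular
  have hdeg : ∀ x x', ∑ z, A z x = ∑ z, A z x' := by
    intro x x'
    obtain ⟨σ, hσ⟩ := exists_smul_eq G x x'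
    have hσ' : (σ : Equiv.Perm α) x = x' := hσ
    rw [← Equiv.sum_comp (σ : Equiv.Perm α) (fun z => A z x'), ← hσ']
    exact sum_congr rfl fun z _ => (hAinv σ σ.2 z x).symm
  have hsame : ∀ x y z, z ≠ x → z ≠ y → (r z x ↔ r z y) := by
    intro x y z hzx hzy
    set v : α → ℝ := Pi.single x 1 - Pi.single y 1 with hv
    have hLv : ∀ w, L v w = A w x - A w y - μ * v w := by
      intro w
      simp [L, hv, Matrix.mulVec_sub]
    have hsum : ∑ w, L v w = 0 := by
      simp only [hLv]
      rw [sum_sub_distrib, sum_sub_distrib, hdeg x y, ← mul_sum]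
      simp [hv]
    have hz : L v z = 0 := by
      rw [sum_congr rfl fun w _ => hconst (L v) ⟨v, rfl⟩ w z, sum_const, nsmul_eq_mul] at hsum
      rcases mul_eq_zero.1 hsum with h | h
      · rw [Nat.cast_eq_zero, card_eq_zero] at h
        exact absurd (mem_univ z) (by rw [h]; simp)
      · exact h
    rw [hLv] at hz
    have hvz : v z = 0 := by simp [hv, hzx, hzy]
    rw [hvz, mul_zero, sub_zero] at hz
    simp only [A, Matrix.of_apply] at hz
    by_cases h1 : r z x <;> by_cases h2 : r z y <;> simp [h1, h2] at hz ⊢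
  have hr0 : r x₀ y₀ := ⟨1, G.one_mem, Or.inl ⟨rfl, rfl⟩⟩
  -- move from `(x₀, y₀)` to `(x₁, y₁)`, one coordinate at a time
  by_cases hy : x₀ = y₁
  · subst hy
    exact hr_symm _ _ ((hsame y₀ x₁ x₀ h₀ h₁.symm).1 hr0)
  · have h2 : r x₀ y₁ := (hsame y₀ y₁ x₀ h₀ hy).1 hr0
    exact hr_symm _ _ ((hsame x₀ x₁ y₁ (Ne.symm hy) h₁.symm).1 (hr_symm _ _ h2))

/-- The entries of the orthogonal projection onto an invariant space. -/
lemma exists_invariant_projection {α : Type*} [Fintype α] [DecidableEq α]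
    {G : Subgroup (Equiv.Perm α)} {W : Submodule ℝ (α → ℝ)} (hW : IsInvariantSpace G W) :
    ∃ E : α → α → ℝ, (∀ σ ∈ G, ∀ x y, E (σ x) (σ y) = E x y) ∧ (∀ x y, E x y = E y x) ∧
      (∀ x, ∑ y, E x y ^ 2 = E x x) ∧ ∑ x, E x x = Module.finrank ℝ W ∧
      ∀ (S T : Finset α) (f : α → ℝ), Disjoint S T → (∀ x ∈ S, ∀ y ∈ T, E x y = f y) →
        4 * ((#S : ℝ) * ∑ y ∈ T, f y ^ 2) ≤ 1 := by
  let ι := WithLp.linearEquiv 2 ℝ (α → ℝ)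
  set V : Submodule ℝ (EuclideanSpace ℝ α) := W.comap (ι : EuclideanSpace ℝ α →ₗ[ℝ] α → ℝ) with hV
  have hVW : Module.finrank ℝ V = Module.finrank ℝ W :=
    LinearEquiv.finrank_eq (ι.submoduleMap V |>.trans (LinearEquiv.ofEq _ _ (by
      rw [hV, Submodule.map_comap_eq_of_surjective ι.surjective])))
  let e : α → EuclideanSpace ℝ α := fun x => EuclideanSpace.single x 1
  let P := V.starProjection
  let E : α → α → ℝ := fun x y => P (e y) x
  have hE : ∀ x y, E x y = inner ℝ (e x) (P (e y)) := by
    intro x y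
    simp [E, e, EuclideanSpace.inner_single_left]
  have hPP : ∀ u v, inner ℝ (P u) v = inner ℝ u (P v) := V.inner_starProjection_left_eq_right
  have hidem : ∀ v, P (P v) = P v := fun v =>
    Submodule.starProjection_eq_self_iff.2 (Submodule.starProjection_apply_mem V v)
  have hsymm : ∀ x y, E x y = E y x := by
    intro x y
    rw [hE, hE, ← hPP, real_inner_comm]
  have hP : ∀ v z, P v z = ∑ y, E z y * v y := by
    intro v z
    have hv : v = ∑ y, v y • e y := by
      have := (EuclideanSpace.basisFun α ℝ).sum_repr v
      simpa [e] using this.symm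
    conv_lhs => rw [hv]
    simp [map_sum, E, mul_comm]
  refine ⟨E, ?_, hsymm, ?_, ?_, ?_⟩
  · intro σ hσ x y
    let T := LinearIsometryEquiv.piLpCongrLeft 2 ℝ ℝ σ
    have hTe : ∀ x, T (e x) = e (σ x) := fun x => EuclideanSpace.piLpCongrLeft_single σ x 1
    have hTV : ∀ v ∈ V, T v ∈ V := by
      intro v hv
      exact hW σ⁻¹ (G.inv_mem hσ) _ hv
    have hTP : P (T (e y)) = T (P (e y)) := by
      refine Submodule.eq_starProjection_of_mem_of_inner_eq_zero
        (hTV _ (Submodule.starProjection_apply_mem V _)) fun w hw => ?_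
      have hw' : T.symm w ∈ V := by
        rw [LinearIsometryEquiv.piLpCongrLeft_symm]
        exact hW σ hσ _ hw
      rw [← map_sub, ← T.apply_symm_apply w, T.inner_map_map]
      exact V.starProjection_inner_eq_zero _ _ hw'
    rw [hE, ← hTe, ← hTe, hTP, T.inner_map_map, ← hE]
  · intro x
    have h := hP (P (e x)) x
    rw [hidem] at h
    change E x x = ∑ y, E x y * E y x at h
    rw [h]
    exact sum_congr rfl fun y _ => by rw [hsymm y x, sq]
  · have hproj : LinearMap.IsProj V (P : EuclideanSpace ℝ α →ₗ[ℝ] EuclideanSpace ℝ α) :=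
      ⟨fun v => Submodule.starProjection_apply_mem V v,
        fun v hv => Submodule.starProjection_eq_self_iff.2 hv⟩
    have h1 := hproj.trace
    rw [LinearMap.trace_eq_sum_inner _ (EuclideanSpace.basisFun α ℝ), hVW] at h1
    rw [← h1]
    exact sum_congr rfl fun x _ => by simp [hE, e]
  · intro S T f hST hf
    set u : EuclideanSpace ℝ α := WithLp.toLp 2 fun z => if z ∈ S then 1 else 0 with hu
    set v : EuclideanSpace ℝ α := WithLp.toLp 2 fun z => if z ∈ T then f z else 0 with hv
    set R := ∑ y ∈ T, f y ^ 2 with hR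
    have hR0 : 0 ≤ R := sum_nonneg fun y _ => sq_nonneg _
    have huu : ‖u‖ ^ 2 = #S := by
      rw [EuclideanSpace.real_norm_sq_eq]
      simp [hu]
    have hvv : ‖v‖ ^ 2 = R := by
      rw [EuclideanSpace.real_norm_sq_eq]
      simp [hv, hR, ite_pow]
    have huv : inner ℝ u v = 0 := by
      rw [PiLp.inner_apply]
      refine sum_eq_zero fun z _ => ?_
      by_cases hz : z ∈ S
      · have : z ∉ T := Finset.disjoint_left.1 hST hz
        simp [hv, this]
      · simp [hu, hz]
    have huPv : inner ℝ u (P v) = #S * R := by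
      rw [PiLp.inner_apply]
      have : ∀ z, inner ℝ (u z) (P v z) = if z ∈ S then R else 0 := by
        intro z
        by_cases hz : z ∈ S
        · rw [hP]
          simp only [hu, hv, hz, if_true, hR]
          simp only [mul_ite, mul_zero, sum_ite_mem, univ_inter]
          rw [real_inner_comm, real_inner_eq_re_inner ℝ]
          simp
          exact sum_congr rfl fun y hy => by rw [hf z hz y hy, sq]
        · simp [hu, hz]
      rw [sum_congr rfl fun z _ => this z]
      simp
    have hrefl : 2 * inner ℝ u (P v) ≤ ‖u‖ * ‖v‖ := by
      have h1 : inner ℝ u (V.reflection v) = 2 * inner ℝ u (P v) := by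
        rw [Submodule.reflection_apply, inner_sub_right, huv, sub_zero, two_smul, inner_add_right,
          two_mul]
      rw [← h1, ← V.reflection.norm_map v]
      exact real_inner_le_norm _ _
    rw [huPv] at hrefl
    have hS0 : (0 : ℝ) ≤ #S := Nat.cast_nonneg _
    have hsq : (2 * (#S * R)) ^ 2 ≤ #S * R := by
      calc (2 * (#S * R)) ^ 2 ≤ (‖u‖ * ‖v‖) ^ 2 :=
            pow_le_pow_left₀ (by positivity) hrefl 2
        _ = #S * R := by rw [mul_pow, huu, hvv]
    have h0 : 0 ≤ #S * R := mul_nonneg hS0 hR0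
    nlinarith

section Cycles

variable {α : Type*} [DecidableEq α] {g : Equiv.Perm α} {A B : Finset α}

lemma card_image_pow_mul (hA : g.IsCycleOn (A : Set α)) {x : α} (hx : x ∈ A) {d : ℕ}
    (hd : d ∣ #A) : #((range (#A / d)).image fun i => (g ^ (d * i)) x) = #A / d := by
  have hA0 : 0 < #A := card_pos.2 ⟨x, hx⟩
  rw [card_image_of_injOn, card_range]
  intro i hi j hj hij
  have h := (hA.pow_apply_eq_pow_apply hx).1 hij
  simp only [coe_range, Set.mem_Iio] at hi hj
  have hlt : ∀ i, i < #A / d → d * i < #A := by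
    intro i hi
    rw [mul_comm]
    exact (Nat.lt_div_iff_mul_lt' hd i).1 hi |>.trans_eq' (mul_comm _ _)
  have := Nat.ModEq.eq_of_lt_of_lt h (hlt i hi) (hlt j hj)
  exact Nat.eq_of_mul_eq_mul_left (Nat.pos_of_dvd_of_pos hd hA0) this

lemma image_pow_mul_subset (hA : g.IsCycleOn (A : Set α)) {x : α} (hx : x ∈ A) (d k : ℕ) :
    ((range k).image fun i => (g ^ (d * i)) x) ⊆ A := by
  intro z hz
  obtain ⟨i, _, rfl⟩ := mem_image.1 hz
  exact (hA.1.perm_pow _).mapsTo hx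

omit [DecidableEq α] in
lemma apply_pow_gcd_mul_eq (hA : g.IsCycleOn (A : Set α)) (hB : g.IsCycleOn (B : Set α))
    {F : α → α → ℝ} (hF : ∀ x y, F (g x) (g y) = F x y) {x y : α} (hx : x ∈ A) (hy : y ∈ B)
    (i : ℕ) : F ((g ^ (Nat.gcd #A #B * i)) x) y = F x y := by
  have hpow : ∀ k : ℕ, F ((g ^ k) x) ((g ^ k) y) = F x y := by
    intro k
    induction k with
    | zero => rfl
    | succ k ih => rw [pow_succ', Equiv.Perm.mul_apply, Equiv.Perm.mul_apply, hF, ih]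
  obtain ⟨k, hk1, hk2⟩ := Nat.chineseRemainder' (n := #A) (m := #B) (a := Nat.gcd #A #B * i)
    (b := 0) ((Nat.modEq_zero_iff_dvd).2 (dvd_mul_right _ _))
  rw [← hpow k, (hA.pow_apply_eq_pow_apply hx).2 hk1, (hB.pow_apply_eq_pow_apply hy).2 hk2]
  rfl

variable {E : α → α → ℝ}
  (hE : ∀ (S T : Finset α) (f : α → ℝ), Disjoint S T → (∀ x ∈ S, ∀ y ∈ T, E x y = f y) →
    4 * ((#S : ℝ) * ∑ y ∈ T, f y ^ 2) ≤ 1)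

include hE in
lemma sum_sq_le_of_cycles (hA : g.IsCycleOn (A : Set α)) (hB : g.IsCycleOn (B : Set α))
    (hAB : Disjoint A B) (hF : ∀ x y, E (g x) (g y) = E x y) {x : α} (hx : x ∈ A) :
    ∑ y ∈ B, E x y ^ 2 ≤ (Nat.gcd #A #B : ℝ) / (4 * #A) := by
  have hd : Nat.gcd #A #B ∣ #A := Nat.gcd_dvd_left _ _
  have h := hE _ B (E x) (hAB.mono_left (image_pow_mul_subset hA hx (Nat.gcd #A #B)
    (#A / Nat.gcd #A #B))) (by
      intro x' hx' y hy
      obtain ⟨i, _, rfl⟩ := mem_image.1 hx'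
      exact apply_pow_gcd_mul_eq hA hB hF hx hy i)
  have hA0 : (0 : ℝ) < #A := by exact_mod_cast card_pos.2 ⟨x, hx⟩
  have hd0 : (0 : ℝ) < Nat.gcd #A #B := by
    exact_mod_cast Nat.gcd_pos_of_pos_left _ (card_pos.2 ⟨x, hx⟩)
  rw [card_image_pow_mul hA hx hd, Nat.cast_div hd hd0.ne'] at h
  rw [le_div_iff₀ (by positivity)]
  have : (#A : ℝ) / Nat.gcd #A #B * ∑ y ∈ B, E x y ^ 2 * 4 ≤ 1 := by
    rw [← sum_mul]; linarith
  rw [div_mul_eq_mul_div, div_le_one hd0, ← sum_mul] at this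
  linarith

include hE in
lemma sq_le_of_cycles (hA : g.IsCycleOn (A : Set α)) (hB : g.IsCycleOn (B : Set α))
    (hAB : Disjoint A B) (hF : ∀ x y, E (g x) (g y) = E x y) {x y : α} (hx : x ∈ A)
    (hy : y ∈ B) : 4 * #A * #B * E x y ^ 2 ≤ (Nat.gcd #A #B : ℝ) ^ 2 := by
  have hd : Nat.gcd #A #B ∣ #A := Nat.gcd_dvd_left _ _
  have hd' : Nat.gcd #A #B ∣ #B := Nat.gcd_dvd_right _ _
  have h := hE _ _ (fun _ => E x y) ((hAB.mono_left (image_pow_mul_subset hA hx (Nat.gcd #A #B)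
    (#A / Nat.gcd #A #B))).mono_right (image_pow_mul_subset hB hy (Nat.gcd #A #B)
    (#B / Nat.gcd #A #B))) (by
      intro x' hx' y' hy'
      obtain ⟨i, _, rfl⟩ := mem_image.1 hx'
      obtain ⟨j, _, rfl⟩ := mem_image.1 hy'
      rw [apply_pow_gcd_mul_eq hA hB hF hx ((hB.1.perm_pow _).mapsTo hy) i]
      rw [Nat.gcd_comm]
      exact apply_pow_gcd_mul_eq hB hA (F := fun u v => E v u) (fun u v => hF v u) hy hx j)
  have hd0 : (0 : ℝ) < Nat.gcd #A #B := by
    exact_mod_cast Nat.gcd_pos_of_pos_left _ (card_pos.2 ⟨x, hx⟩)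
  rw [card_image_pow_mul hA hx hd, sum_const, card_image_pow_mul hB hy hd', nsmul_eq_mul,
    Nat.cast_div hd hd0.ne', Nat.cast_div hd' hd0.ne'] at h
  have e : 4 * ((#A : ℝ) / Nat.gcd #A #B * (#B / Nat.gcd #A #B * E x y ^ 2)) =
      4 * #A * #B * E x y ^ 2 / (Nat.gcd #A #B : ℝ) ^ 2 := by
    field_simp
  rw [e, div_le_one (by positivity)] at h
  exact h

end Cycles

/-- A permutation with three cycles of nearly coprime lengths forces a gap in the dimensions of
the invariant spaces of a primitive group containing it. -/
theorem finrank_gap_of_three_cycles {α : Type*} [Fintype α] [DecidableEq α]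
    {G : Subgroup (Equiv.Perm α)} [IsPreprimitive G α] {g : Equiv.Perm α} (hg : g ∈ G)
    {A B C : Finset α}
    (hA : g.IsCycleOn (A : Set α)) (hB : g.IsCycleOn (B : Set α)) (hC : g.IsCycleOn (C : Set α))
    (hAB : Disjoint A B) (hAC : Disjoint A C) (hBC : Disjoint B C) (hU : A ∪ B ∪ C = univ)
    (hA0 : A.Nonempty) (hB0 : B.Nonempty) (hC0 : C.Nonempty) {η : ℝ}
    (hη₁ : (Nat.gcd #C #A : ℝ) ^ 2 ≤ 4 * #C * #A * η)
    (hη₂ : (Nat.gcd #C #B : ℝ) ^ 2 ≤ 4 * #C * #B * η) {K : ℕ}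
    (hK : (Fintype.card α : ℝ) ^ 2 * ((Nat.gcd #A #B + Nat.gcd #A #C) / (4 * #A) + #A * η) <
      (K + 1) * (Fintype.card α - K - 1))
    {W : Submodule ℝ (α → ℝ)} (hW : IsInvariantSpace G W) :
    Module.finrank ℝ W ≤ K ∨ Fintype.card α ≤ Module.finrank ℝ W + K := by
  obtain ⟨E, hinv, hsymm, hsq, htr, hE⟩ := exists_invariant_projection hW
  have hF := hinv g hg
  obtain ⟨x, hx⟩ := hA0
  have hC0' : (0 : ℝ) < #C := by exact_mod_cast card_pos.2 hC0
  have hB0' : (0 : ℝ) < #B := by exact_mod_cast card_pos.2 hB0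
  have hA0' : (0 : ℝ) < #A := by exact_mod_cast card_pos.2 ⟨x, hx⟩
  have hη0 : 0 ≤ η := by
    by_contra! hneg
    have : 4 * (#C : ℝ) * #A * η < 0 := mul_neg_of_pos_of_neg (by positivity) hneg
    linarith [sq_nonneg (Nat.gcd #C #A : ℝ)]
  have hmem : ∀ z, z ∈ A ∨ z ∈ B ∨ z ∈ C := by
    intro z
    have : z ∈ A ∪ B ∪ C := by rw [hU]; exact mem_univ z
    simpa [or_assoc] using this
  have hoff : ∀ u v, u ≠ v → E u v ^ 2 ≤ η := by
    intro u v huv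
    obtain ⟨σ, hσu, hσv⟩ := IsPreprimitive.exists_mem_smul_and_notMem_smul (G := G)
      (A := (C : Set α)) (Set.toFinite _) (Finset.coe_nonempty.2 hC0) (by
        intro h
        have : x ∈ (C : Set α) := by rw [h]; trivial
        exact Finset.disjoint_left.1 hAC hx (by simpa using this)) huv
    rw [Set.mem_smul_set_iff_inv_smul_mem] at hσu hσv
    rw [← hinv _ (σ⁻¹).2 u v]
    set u' := ((σ⁻¹ : G) : Equiv.Perm α) u
    set v' := ((σ⁻¹ : G) : Equiv.Perm α) v
    have hu' : u' ∈ C := hσu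
    have hv' : v' ∉ C := hσv
    rcases hmem v' with h | h | h
    · have := (sq_le_of_cycles hE hC hA hAC.symm hF hu' h).trans hη₁
      exact le_of_mul_le_mul_left this (by positivity)
    · have := (sq_le_of_cycles hE hC hB hBC.symm hF hu' h).trans hη₂
      exact le_of_mul_le_mul_left this (by positivity)
    · exact absurd h hv'
  have hdiag : ∀ y, E y y = E x x := by
    intro y
    obtain ⟨σ, hσ⟩ := exists_smul_eq G x y
    rw [← hσ]
    exact hinv _ σ.2 x x
  set n : ℝ := ((Fintype.card α : ℕ) : ℝ) with hn
  set w : ℝ := ((Module.finrank ℝ W : ℕ) : ℝ) with hw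
  have hnE : n * E x x = w := by
    rw [← htr, sum_congr rfl fun y _ => hdiag y, sum_const, card_univ, nsmul_eq_mul]
  have hrow : E x x ≤ E x x ^ 2 + #A * η +
      ((Nat.gcd #A #B : ℝ) / (4 * #A) + (Nat.gcd #A #C : ℝ) / (4 * #A)) := by
    have h1 : ∑ y ∈ A, E x y ^ 2 ≤ E x x ^ 2 + #A * η := by
      rw [← add_sum_erase _ _ hx]
      gcongr
      calc ∑ y ∈ A.erase x, E x y ^ 2 ≤ ∑ y ∈ A.erase x, η :=
            sum_le_sum fun y hy => hoff x y (ne_of_mem_erase hy).symm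
        _ ≤ #A * η := by
            rw [sum_const, nsmul_eq_mul]
            gcongr
            exact erase_subset _ _
    have h2 := sum_sq_le_of_cycles hE hA hB hAB hF hx
    have h3 := sum_sq_le_of_cycles hE hA hC hAC hF hx
    calc E x x = ∑ y ∈ A ∪ B ∪ C, E x y ^ 2 := by rw [hU, hsq]
      _ = ∑ y ∈ A, E x y ^ 2 + ∑ y ∈ B, E x y ^ 2 + ∑ y ∈ C, E x y ^ 2 := by
          rw [sum_union (disjoint_union_left.2 ⟨hAC, hBC⟩), sum_union hAB]
      _ ≤ _ := by linarith
  have hww : w * (n - w) < (K + 1) * (n - K - 1) := by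
    refine lt_of_le_of_lt ?_ hK
    rw [← hnE]
    have := mul_le_mul_of_nonneg_left hrow (sq_nonneg n)
    rw [← add_div] at this
    linarith
  by_contra! hcon
  have h1 : (K : ℝ) + 1 ≤ w := by rw [hw]; exact_mod_cast hcon.1
  have h2 : w + K + 1 ≤ n := by rw [hw, hn]; exact_mod_cast hcon.2
  nlinarith

/-- The triples of cycle lengths to which the transitivity obstruction below applies, for
permutations of `x ^ 4` points. -/
structure IsGoodTriple (D : ℕ) (x : ℝ) (a b c : ℕ) : Prop where
  le_fst : 2 / 5 * x ^ 3 ≤ a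
  le_snd : 2 / 5 * x ^ 3 ≤ b
  le_trd : 2 / 5 * x ^ 3 ≤ c
  gcd_fst_snd : Nat.gcd a b ≤ D
  gcd_fst_trd : Nat.gcd a c ≤ D
  gcd_snd_trd : Nat.gcd b c ≤ D
  gcd_eq_one : Nat.gcd (Nat.gcd a b) c = 1
  fst_snd : ¬ IsImprimitiveTriple a b c
  fst_trd : ¬ IsImprimitiveTriple a c b
  snd_trd : ¬ IsImprimitiveTriple b c a
  exists_small : 3 * a + 4 * x ^ 2 ≤ x ^ 4 ∨ 3 * b + 4 * x ^ 2 ≤ x ^ 4 ∨ 3 * c + 4 * x ^ 2 ≤ x ^ 4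

/-- The choice of the dimension bound for the spectral gap. -/
lemma exists_dimension_bound {n : ℕ} {x : ℝ} (hx : 9 ≤ x) (hxn : x ^ 4 = n) :
    ∃ K : ℕ, (K + 1).choose 2 + K < n ∧ 2 * K + 1 < n ∧
      87 / 64 * x ^ 6 < (K + 1) * (n - K - 1) := by
  have hs0 : 0 ≤ √2 := Real.sqrt_nonneg 2
  have hs : √2 ^ 2 = 2 := Real.sq_sqrt (by norm_num)
  have hs1 : 1.4142 ≤ √2 := by apply Real.le_sqrt_of_sq_le; norm_num
  have hs2 : √2 ≤ 1.4143 := by apply Real.sqrt_le_iff.2; norm_num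
  have hx2 : 81 ≤ x ^ 2 := by nlinarith
  have h0 : 0 ≤ √2 * x ^ 2 - 3 / 2 := by nlinarith
  set K := ⌊√2 * x ^ 2 - 3 / 2⌋₊ with hK
  have hK1 : (K : ℝ) ≤ √2 * x ^ 2 - 3 / 2 := Nat.floor_le h0
  have hK2 : √2 * x ^ 2 - 3 / 2 < K + 1 := Nat.lt_floor_add_one _
  have hK0 : (0 : ℝ) ≤ K := K.cast_nonneg
  have hn : (n : ℝ) = (x ^ 2) ^ 2 := by rw [← hxn]; ring
  have hsq : (K : ℝ) ^ 2 + 3 * K < 2 * n := by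
    have : ((K : ℝ) + 3 / 2) ^ 2 ≤ (√2 * x ^ 2) ^ 2 := by
      apply pow_le_pow_left₀ (by positivity); linarith
    rw [mul_pow, hs, ← hn] at this
    nlinarith
  refine ⟨K, ?_, ?_, ?_⟩
  · have h1 : (K ^ 2 + 3 * K : ℕ) < 2 * n := by exact_mod_cast hsq
    have h2 : (K + 1).choose 2 * 2 = (K + 1) * K := by
      have := Nat.choose_two_right (K + 1)
      rw [this, Nat.div_mul_cancel]
      · simp
      · exact (Nat.even_mul_pred_self (K + 1)).two_dvd
    nlinarith
  · have : 2 * (K : ℝ) + 1 < n := by rw [hn]; nlinarith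
    exact_mod_cast this
  · have e : (n : ℝ) - K - 1 ≥ x ^ 2 * (x ^ 2 - 1.4143) := by rw [hn]; nlinarith
    have e' : 1.4142 * x ^ 2 - 1.5 ≤ (K : ℝ) + 1 := by nlinarith
    calc 87 / 64 * x ^ 6 < (1.4142 * x ^ 2 - 1.5) * (x ^ 2 * (x ^ 2 - 1.4143)) := by
          have : 0 < x ^ 2 * ((1.4142 * x ^ 2 - 1.5) * (x ^ 2 - 1.4143) - 87 / 64 * x ^ 4) := by
            apply mul_pos (by positivity)
            nlinarith
          nlinarith
      _ ≤ _ := by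
          apply mul_le_mul e' e
          · apply mul_nonneg (by positivity); linarith
          · linarith

section ThreeCycles

variable {α : Type*} [Fintype α] [DecidableEq α] {G : Subgroup (Equiv.Perm α)} {g : Equiv.Perm α}
  {A B C : Finset α} {D : ℕ} {x : ℝ}

lemma isPairHomogeneous_of_three_cycles_of_le [IsPreprimitive G α] (hg : g ∈ G)
    (hA : g.IsCycleOn (A : Set α)) (hB : g.IsCycleOn (B : Set α)) (hC : g.IsCycleOn (C : Set α))
    (hAB : Disjoint A B) (hAC : Disjoint A C) (hBC : Disjoint B C) (hU : A ∪ B ∪ C = univ)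
    (hx : 9 ≤ x) (hxn : x ^ 4 = Fintype.card α) (hD : 4 * D ≤ 3 * x)
    (hA0 : 2 / 5 * x ^ 3 ≤ #A) (h1 : Nat.gcd #A #B ≤ D) (h2 : Nat.gcd #A #C ≤ D)
    (h3 : Nat.gcd #B #C ≤ D) (hle₁ : #A ≤ #B) (hle₂ : #B ≤ #C) : IsPairHomogeneous G := by
  obtain ⟨K, hK, hK1, hK2⟩ := exists_dimension_bound hx hxn
  have ha : (0 : ℝ) < #A := lt_of_lt_of_le (by positivity) hA0
  have hb : (0 : ℝ) < #B := lt_of_lt_of_le ha (by exact_mod_cast hle₁)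
  have hc : (0 : ℝ) < #C := lt_of_lt_of_le hb (by exact_mod_cast hle₂)
  have hcard : (#A + #B + #C : ℝ) = x ^ 4 := by
    rw [hxn, ← card_univ, ← hU, card_union_of_disjoint (disjoint_union_left.2 ⟨hAC, hBC⟩),
      card_union_of_disjoint hAB]
    push_cast; rfl
  have hab : (#A : ℝ) ≤ #B := by exact_mod_cast hle₁
  have hbc : (#B : ℝ) ≤ #C := by exact_mod_cast hle₂
  have h1' : (Nat.gcd #A #B : ℝ) ≤ D := by exact_mod_cast h1
  have h2' : (Nat.gcd #A #C : ℝ) ≤ D := by exact_mod_cast h2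
  have h3' : (Nat.gcd #B #C : ℝ) ≤ D := by exact_mod_cast h3
  have hD0 : (0 : ℝ) ≤ D := D.cast_nonneg
  refine isPairHomogeneous_of_gap hK hK1 fun W hW => finrank_gap_of_three_cycles hg hA hB hC hAB
    hAC hBC hU (card_pos.1 (by exact_mod_cast ha)) (card_pos.1 (by exact_mod_cast hb))
    (card_pos.1 (by exact_mod_cast hc)) (η := (D : ℝ) ^ 2 / (4 * #C * #A)) ?_ ?_ ?_ hW
  · rw [Nat.gcd_comm, mul_div_cancel₀ _ (by positivity)]
    gcongr
  · rw [Nat.gcd_comm, mul_div_assoc', le_div_iff₀ (by positivity)]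
    calc (Nat.gcd #B #C : ℝ) ^ 2 * (4 * #C * #A) ≤ (D : ℝ) ^ 2 * (4 * #C * #B) := by gcongr
      _ = _ := by ring
  · refine lt_of_le_of_lt ?_ hK2
    rw [← hxn]
    have hx0 : 0 < x := by linarith
    have e1 : (Nat.gcd #A #B + Nat.gcd #A #C : ℝ) / (4 * #A) ≤ 15 / (16 * x ^ 2) := by
      rw [div_le_div_iff₀ (by positivity) (by positivity)]
      calc (Nat.gcd #A #B + Nat.gcd #A #C : ℝ) * (16 * x ^ 2) ≤ (3 / 2 * x) * (16 * x ^ 2) := by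
            gcongr; linarith
        _ = 15 * (4 * (2 / 5 * x ^ 3)) := by ring
        _ ≤ _ := by gcongr
    have e2 : #A * ((D : ℝ) ^ 2 / (4 * #C * #A)) ≤ 27 / (64 * x ^ 2) := by
      have : #A * ((D : ℝ) ^ 2 / (4 * #C * #A)) = (D : ℝ) ^ 2 / (4 * #C) := by field_simp
      rw [this, div_le_div_iff₀ (by positivity) (by positivity)]
      have hD' : (D : ℝ) ≤ 3 / 4 * x := by linarith
      calc (D : ℝ) ^ 2 * (64 * x ^ 2) ≤ (3 / 4 * x) ^ 2 * (64 * x ^ 2) := by gcongr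
        _ = 36 * x ^ 4 := by ring
        _ ≤ _ := by linarith
    calc (x ^ 4) ^ 2 * ((Nat.gcd #A #B + Nat.gcd #A #C : ℝ) / (4 * #A) +
          #A * ((D : ℝ) ^ 2 / (4 * #C * #A)))
        ≤ (x ^ 4) ^ 2 * (15 / (16 * x ^ 2) + 27 / (64 * x ^ 2)) := by gcongr
      _ = 87 / 64 * x ^ 6 := by field_simp; norm_num

lemma isPairHomogeneous_of_three_cycles [IsPreprimitive G α] (hg : g ∈ G)
    (hA : g.IsCycleOn (A : Set α)) (hB : g.IsCycleOn (B : Set α)) (hC : g.IsCycleOn (C : Set α))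
    (hAB : Disjoint A B) (hAC : Disjoint A C) (hBC : Disjoint B C) (hU : A ∪ B ∪ C = univ)
    (hx : 9 ≤ x) (hxn : x ^ 4 = Fintype.card α) (hD : 4 * D ≤ 3 * x)
    (h : IsGoodTriple D x #A #B #C) : IsPairHomogeneous G := by
  have hBA := hAB.symm
  have hCA := hAC.symm
  have hCB := hBC.symm
  have g1 := h.gcd_fst_snd
  have g2 := h.gcd_fst_trd
  have g3 := h.gcd_snd_trd
  have g1' := Nat.gcd_comm #A #B ▸ g1
  have g2' := Nat.gcd_comm #A #C ▸ g2
  have g3' := Nat.gcd_comm #B #C ▸ g3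
  rcases le_total #A #B with h1 | h1 <;> rcases le_total #A #C with h2 | h2 <;>
    rcases le_total #B #C with h3 | h3
  · exact isPairHomogeneous_of_three_cycles_of_le hg hA hB hC hAB hAC hBC hU hx hxn hD h.le_fst
      g1 g2 g3 h1 h3
  · exact isPairHomogeneous_of_three_cycles_of_le hg hA hC hB hAC hAB hCB
      (by rw [← hU, union_right_comm]) hx hxn hD h.le_fst g2 g1 g3' h2 h3
  · exact isPairHomogeneous_of_three_cycles_of_le hg hA hB hC hAB hAC hBC hU hx hxn hD h.le_fst
      g1 g2 g3 h1 h3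
  · exact isPairHomogeneous_of_three_cycles_of_le hg hC hA hB hCA hCB hAB
      (by rw [← hU]; ext; simp; tauto) hx hxn hD h.le_trd g2' g3' g1 h2 h1
  · exact isPairHomogeneous_of_three_cycles_of_le hg hB hA hC hBA hBC hAC
      (by rw [← hU, union_comm B A]) hx hxn hD h.le_snd g1' g3 g2 h1 h2
  · exact isPairHomogeneous_of_three_cycles_of_le hg hB hA hC hBA hBC hAC
      (by rw [← hU, union_comm B A]) hx hxn hD h.le_snd g1' g3 g2 h1 h2
  · exact isPairHomogeneous_of_three_cycles_of_le hg hB hC hA hBC hBA hCA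
      (by rw [← hU, union_comm, union_assoc]) hx hxn hD h.le_snd g3 g1' g2' h3 h2
  · exact isPairHomogeneous_of_three_cycles_of_le hg hC hB hA hCB hCA hBA
      (by rw [← hU]; ext; simp; tauto) hx hxn hD h.le_trd g3' g2' g1' h3 h1

lemma not_small_cycle_of_isPairHomogeneous [IsPreprimitive G α] (hG : IsPairHomogeneous G)
    (hGA : ¬ alternatingGroup α ≤ G) (hg : g ∈ G)
    (hA : g.IsCycleOn (A : Set α)) (hB : g.IsCycleOn (B : Set α)) (hC : g.IsCycleOn (C : Set α))
    (hU : A ∪ B ∪ C = univ) (hx : 9 ≤ x) (hxn : x ^ 4 = Fintype.card α) (hD : 4 * D ≤ 3 * x)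
    (hA0 : 2 / 5 * x ^ 3 ≤ #A) (h1 : Nat.gcd #A #B ≤ D) (h2 : Nat.gcd #A #C ≤ D) :
    ¬ 3 * #A + 4 * x ^ 2 ≤ x ^ 4 := by
  intro hsmall
  have ha : (0 : ℝ) < #A := lt_of_lt_of_le (by positivity) hA0
  set h := g ^ (#B * #C) with hh
  have hB1 : ∀ z ∈ B, h z = z := by
    intro z hz
    rw [hh, hB.pow_apply_eq hz]
    exact dvd_mul_right _ _
  have hC1 : ∀ z ∈ C, h z = z := by
    intro z hz
    rw [hh, hC.pow_apply_eq hz]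
    exact dvd_mul_left _ _
  have hsupp : h.support ⊆ A := by
    intro z hz
    have hzU : z ∈ A ∪ B ∪ C := by rw [hU]; exact mem_univ z
    rw [Equiv.Perm.mem_support] at hz
    simp only [mem_union] at hzU
    rcases hzU with (h' | h') | h'
    · exact h'
    · exact absurd (hB1 z h') hz
    · exact absurd (hC1 z h') hz
  have hle : (#h.support : ℝ) ≤ #A := by exact_mod_cast card_le_card hsupp
  have hne : h ≠ 1 := by
    intro h1'
    obtain ⟨z, hz⟩ := card_pos.1 (show 0 < #A by exact_mod_cast ha)
    have hdvd : #A ∣ #B * #C := by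
      rw [← hA.pow_apply_eq hz, ← hh, h1']; rfl
    have hdvd' : #A ∣ Nat.gcd #A #B * Nat.gcd #A #C :=
      (Nat.dvd_gcd dvd_rfl hdvd).trans (Nat.gcd_mul_right_dvd_mul_gcd _ _ _)
    have hpos : 0 < #A := by exact_mod_cast ha
    have : #A ≤ D * D := (Nat.le_of_dvd (Nat.mul_pos (Nat.gcd_pos_of_pos_left _ hpos)
      (Nat.gcd_pos_of_pos_left _ hpos)) hdvd').trans (Nat.mul_le_mul h1 h2)
    have hr : (#A : ℝ) ≤ D * D := by exact_mod_cast this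
    have hD0 : (0 : ℝ) ≤ D := D.cast_nonneg
    have hDx : (D : ℝ) * D ≤ (3 / 4 * x) * (3 / 4 * x) := by
      apply mul_le_mul <;> linarith
    have : x ^ 2 * 9 ≤ x ^ 3 := by
      rw [pow_succ x 2]; gcongr
    nlinarith
  have hx2 : 81 ≤ x ^ 2 := by nlinarith
  have hx4 : 81 * x ^ 2 ≤ x ^ 4 := by nlinarith
  have hcard : 300 ≤ Fintype.card α := by
    have : (300 : ℝ) ≤ Fintype.card α := by rw [← hxn]; linarith
    exact_mod_cast this
  have h3 : 3 * #h.support < Fintype.card α := by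
    have : 3 * (#h.support : ℝ) < Fintype.card α := by rw [← hxn]; linarith
    exact_mod_cast this
  have key := not_small_support_of_isPairHomogeneous hG hGA hcard (G.pow_mem hg (#B * #C)) hne h3
  rw [← hxn] at key
  have : (4 * x ^ 2) ^ 2 ≤ (x ^ 4 - 3 * #h.support) ^ 2 := by
    apply pow_le_pow_left₀ (by positivity); linarith
  nlinarith

/-- A proper subgroup not containing the alternating group, which has an element with three
cycles of good lengths, is intransitive. -/
theorem not_isPretransitive_of_three_cycles (hGA : ¬ alternatingGroup α ≤ G) (hg : g ∈ G)
    (hA : g.IsCycleOn (A : Set α)) (hB : g.IsCycleOn (B : Set α)) (hC : g.IsCycleOn (C : Set α))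
    (hAB : Disjoint A B) (hAC : Disjoint A C) (hBC : Disjoint B C) (hU : A ∪ B ∪ C = univ)
    (hx : 9 ≤ x) (hxn : x ^ 4 = Fintype.card α) (hD : 4 * D ≤ 3 * x)
    (h : IsGoodTriple D x #A #B #C) : ¬ IsPretransitive G α := by
  intro hG
  have hpos : ∀ S : Finset α, 2 / 5 * x ^ 3 ≤ #S → S.Nonempty := fun S hS => card_pos.1 (by
    exact_mod_cast lt_of_lt_of_le (by positivity : (0 : ℝ) < 2 / 5 * x ^ 3) hS)
  have := isPreprimitive_of_three_cycles hg hA hB hC hAB hAC hBC hU (hpos _ h.le_fst)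
    (hpos _ h.le_snd) (hpos _ h.le_trd) h.gcd_eq_one h.fst_snd h.fst_trd h.snd_trd
  have hP := isPairHomogeneous_of_three_cycles hg hA hB hC hAB hAC hBC hU hx hxn hD h
  rcases h.exists_small with hs | hs | hs
  · exact not_small_cycle_of_isPairHomogeneous hP hGA hg hA hB hC hU hx hxn hD h.le_fst
      h.gcd_fst_snd h.gcd_fst_trd hs
  · exact not_small_cycle_of_isPairHomogeneous hP hGA hg hB hA hC (by rw [← hU, union_comm B A])
      hx hxn hD h.le_snd (Nat.gcd_comm #A #B ▸ h.gcd_fst_snd) h.gcd_snd_trd hs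
  · exact not_small_cycle_of_isPairHomogeneous hP hGA hg hC hA hB
      (by rw [← hU, union_assoc, union_comm]) hx hxn hD h.le_trd
      (Nat.gcd_comm #A #C ▸ h.gcd_fst_trd) (Nat.gcd_comm #B #C ▸ h.gcd_snd_trd) hs

/-- An orbit of an intransitive group containing an element with three cycles is, up to
complement, one of the cycles. -/
lemma ncard_orbit_of_three_cycles (hG : ¬ IsPretransitive G α) (hg : g ∈ G)
    (hA : g.IsCycleOn (A : Set α)) (hB : g.IsCycleOn (B : Set α)) (hC : g.IsCycleOn (C : Set α))
    (hAB : Disjoint A B) (hAC : Disjoint A C) (hBC : Disjoint B C) (hU : A ∪ B ∪ C = univ)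
    (z : α) : ∃ p, (p = #A ∨ p = #B ∨ p = #C) ∧
      ((orbit G z).ncard = p ∨ (orbit G z).ncard + p = Fintype.card α) := by
  classical
  set O : Finset α := (orbit G z).toFinset with hO
  have hmem : ∀ y, y ∈ O ↔ y ∈ orbit G z := fun y => Set.mem_toFinset
  have hncard : (orbit G z).ncard = #O := Set.ncard_eq_toFinset_card' _
  have hcyc : ∀ S : Finset α, g.IsCycleOn (S : Set α) → S ⊆ O ∨ Disjoint S O := by
    intro S hS
    by_contra! hcon
    obtain ⟨u, hu, huO⟩ := not_subset.1 hcon.1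
    obtain ⟨v, hv, hvO⟩ := not_disjoint_iff.1 hcon.2
    obtain ⟨k, -, hk⟩ := hS.exists_pow_eq hv hu
    rw [hmem] at huO hvO
    refine huO ?_
    rw [← hk]
    exact (orbit_eq_iff.2 hvO) ▸ mem_orbit v (⟨g ^ k, G.pow_mem hg k⟩ : G)
  have hOne : O ≠ univ := by
    intro h
    refine hG ⟨fun u v => ?_⟩
    have hu : u ∈ orbit G z := (hmem u).1 (h ▸ mem_univ u)
    have hv : v ∈ orbit G z := (hmem v).1 (h ▸ mem_univ v)
    rw [← orbit_eq_iff.2 hu] at hv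
    exact hv
  have hO0 : O ≠ ∅ := by
    intro h
    have := (hmem z).2 (mem_orbit_self z)
    simp [h] at this
  have hcardU : #A + #B + #C = Fintype.card α := by
    rw [← card_univ, ← hU, card_union_of_disjoint (disjoint_union_left.2 ⟨hAC, hBC⟩),
      card_union_of_disjoint hAB]
  have hcard : #O = #(A ∩ O) + #(B ∩ O) + #(C ∩ O) := by
    rw [← card_union_of_disjoint, ← card_union_of_disjoint, ← union_inter_distrib_right,
      ← union_inter_distrib_right, hU, univ_inter]
    · rw [← union_inter_distrib_right]
      exact (disjoint_union_left.2 ⟨hAC, hBC⟩).mono inter_subset_left inter_subset_left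
    · exact hAB.mono inter_subset_left inter_subset_left
  have hval : ∀ S : Finset α, g.IsCycleOn (S : Set α) → #(S ∩ O) = #S ∨ #(S ∩ O) = 0 := by
    intro S hS
    rcases hcyc S hS with h | h
    · left; rw [inter_eq_left.2 h]
    · right; rw [disjoint_iff_inter_eq_empty.1 h, card_empty]
  have hlt : #O < Fintype.card α := card_lt_univ_of_notMem
    (not_forall.1 fun h => hOne (eq_univ_iff_forall.2 h)).choose_spec
  have hpos : 0 < #O := card_pos.2 (nonempty_iff_ne_empty.2 hO0)
  rw [hncard]
  rcases hval A hA with h1 | h1 <;> rcases hval B hB with h2 | h2 <;>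
    rcases hval C hC with h3 | h3 <;> rw [h1, h2, h3] at hcard
  · omega
  · exact ⟨#C, by simp, by omega⟩
  · exact ⟨#B, by simp, by omega⟩
  · exact ⟨#A, by simp, by omega⟩
  · exact ⟨#A, by simp, by omega⟩
  · exact ⟨#B, by simp, by omega⟩
  · exact ⟨#C, by simp, by omega⟩
  · omega

end ThreeCycles

/-- Pairs of residues modulo `m` that are not both divisible by any prime of `S`. -/
lemma card_filter_not_dvd {S : Finset ℕ} (hS : ∀ p ∈ S, p.Prime) {m : ℕ} (hm : ∏ p ∈ S, p ∣ m) :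
    (#{t ∈ range m ×ˢ range m | ∀ p ∈ S, ¬(p ∣ t.1 ∧ p ∣ t.2)} : ℝ) =
      m ^ 2 * ∏ p ∈ S, (1 - 1 / (p : ℝ) ^ 2) := by
  induction S using Finset.induction_on generalizing m with
  | empty => simp [sq]
  | insert q S hq ih =>
    have hqp : q.Prime := hS q (mem_insert_self _ _)
    have hS' : ∀ p ∈ S, p.Prime := fun p hp => hS p (mem_insert_of_mem hp)
    rw [prod_insert hq] at hm ⊢
    obtain ⟨r, rfl⟩ : q ∣ m := (dvd_mul_right _ _).trans hm
    have hr : ∏ p ∈ S, p ∣ r := Nat.dvd_of_mul_dvd_mul_left hqp.pos hm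
    have h1 := ih hS' ((dvd_mul_left _ _).trans hm)
    have h2 := ih hS' hr
    have himg : ({t ∈ range (q * r) ×ˢ range (q * r) |
        (∀ p ∈ S, ¬(p ∣ t.1 ∧ p ∣ t.2)) ∧ (q ∣ t.1 ∧ q ∣ t.2)}) =
        ({t ∈ range r ×ˢ range r | ∀ p ∈ S, ¬(p ∣ t.1 ∧ p ∣ t.2)}).image
          fun t => (q * t.1, q * t.2) := by
      have hcop : ∀ p ∈ S, ∀ k, p ∣ q * k ↔ p ∣ k := by
        intro p hp k
        refine ((Nat.coprime_primes (hS' p hp) hqp).2 ?_).dvd_mul_left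
        rintro rfl; exact hq hp
      ext ⟨a, b⟩
      simp only [mem_filter, mem_product, mem_range, mem_image, Prod.mk.injEq, Prod.exists]
      constructor
      · rintro ⟨⟨ha, hb⟩, h, ⟨k, rfl⟩, ⟨l, rfl⟩⟩
        refine ⟨k, l, ⟨⟨Nat.lt_of_mul_lt_mul_left ha, Nat.lt_of_mul_lt_mul_left hb⟩,
          fun p hp => ?_⟩, rfl, rfl⟩
        have := h p hp
        rwa [hcop p hp, hcop p hp] at this
      · rintro ⟨k, l, ⟨⟨hk, hl⟩, h⟩, rfl, rfl⟩
        refine ⟨⟨Nat.mul_lt_mul_of_pos_left hk hqp.pos, Nat.mul_lt_mul_of_pos_left hl hqp.pos⟩,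
          fun p hp => ?_, dvd_mul_right _ _, dvd_mul_right _ _⟩
        rw [hcop p hp, hcop p hp]
        exact h p hp
    have hcard : #{t ∈ range (q * r) ×ˢ range (q * r) |
        (∀ p ∈ S, ¬(p ∣ t.1 ∧ p ∣ t.2)) ∧ (q ∣ t.1 ∧ q ∣ t.2)} =
        #{t ∈ range r ×ˢ range r | ∀ p ∈ S, ¬(p ∣ t.1 ∧ p ∣ t.2)} := by
      rw [himg, card_image_of_injective]
      rintro ⟨a, b⟩ ⟨c, d⟩ h
      simpa [hqp.ne_zero] using h
    have hsplit := card_filter_add_card_filter_not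
      (s := {t ∈ range (q * r) ×ˢ range (q * r) | ∀ p ∈ S, ¬(p ∣ t.1 ∧ p ∣ t.2)})
      (p := fun t => q ∣ t.1 ∧ q ∣ t.2)
    rw [filter_filter, filter_filter, hcard] at hsplit
    have hins : ({t ∈ range (q * r) ×ˢ range (q * r) |
        ∀ p ∈ insert q S, ¬(p ∣ t.1 ∧ p ∣ t.2)}) = {t ∈ range (q * r) ×ˢ range (q * r) |
        (∀ p ∈ S, ¬(p ∣ t.1 ∧ p ∣ t.2)) ∧ ¬(q ∣ t.1 ∧ q ∣ t.2)} := by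
      refine filter_congr fun t _ => ?_
      rw [forall_mem_insert, and_comm]
    have hsplit' : (#{t ∈ range r ×ˢ range r | ∀ p ∈ S, ¬(p ∣ t.1 ∧ p ∣ t.2)} : ℝ) +
        #{t ∈ range (q * r) ×ˢ range (q * r) | ∀ p ∈ insert q S, ¬(p ∣ t.1 ∧ p ∣ t.2)} =
        #{t ∈ range (q * r) ×ˢ range (q * r) | ∀ p ∈ S, ¬(p ∣ t.1 ∧ p ∣ t.2)} := by
      rw [hins]; exact_mod_cast hsplit
    have hq0 : (q : ℝ) ≠ 0 := by exact_mod_cast hqp.ne_zero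
    rw [h1, h2] at hsplit'
    rw [eq_sub_of_add_eq' hsplit']
    push_cast
    field_simp

/-- Pairs of residues modulo `n` generating `ℤ / n`; the count is Jordan's totient. -/
lemma card_filter_gcd_eq_one {n : ℕ} (hn : n ≠ 0) :
    (#{t ∈ range n ×ˢ range n | Nat.gcd (Nat.gcd t.1 t.2) n = 1} : ℝ) =
      n ^ 2 * ∏ p ∈ n.primeFactors, (1 - 1 / (p : ℝ) ^ 2) := by
  rw [← card_filter_not_dvd (fun p hp => Nat.prime_of_mem_primeFactors hp)
    (Nat.prod_primeFactors_dvd n)]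
  congr 2
  refine filter_congr fun t _ => ?_
  constructor
  · intro h p hp hdvd
    have : p ∣ 1 := h ▸ Nat.dvd_gcd (Nat.dvd_gcd hdvd.1 hdvd.2) (Nat.dvd_of_mem_primeFactors hp)
    exact (Nat.prime_of_mem_primeFactors hp).one_lt.ne' (Nat.dvd_one.1 this)
  · intro h
    by_contra hne
    obtain ⟨p, hp, hdvd⟩ := Nat.exists_prime_and_dvd hne
    rw [Nat.dvd_gcd_iff, Nat.dvd_gcd_iff] at hdvd
    exact h p (Nat.mem_primeFactors.2 ⟨hp, hdvd.2, hn⟩) hdvd.1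

/-- Ordered triples of positive integers with sum `n`. -/
def positiveTriples (n : ℕ) : Finset (ℕ × ℕ × ℕ) :=
  {t ∈ range n ×ˢ range n ×ˢ range n |
    0 < t.1 ∧ 0 < t.2.1 ∧ 0 < t.2.2 ∧ t.1 + t.2.1 + t.2.2 = n}

lemma mem_positiveTriples {n a b c : ℕ} :
    (a, b, c) ∈ positiveTriples n ↔ 0 < a ∧ 0 < b ∧ 0 < c ∧ a + b + c = n := by
  simp only [positiveTriples, mem_filter, mem_product, mem_range]
  constructor
  · rintro ⟨-, h⟩; exact h
  · rintro h; exact ⟨⟨by omega, by omega, by omega⟩, h⟩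

lemma card_filter_rotate (n : ℕ) (P : ℕ × ℕ × ℕ → Prop) [DecidablePred P] :
    #{t ∈ positiveTriples n | P (t.2.1, t.2.2, t.1)} = #{t ∈ positiveTriples n | P t} := by
  refine card_bij (fun t _ => (t.2.1, t.2.2, t.1)) ?_ ?_ ?_
  · rintro ⟨a, b, c⟩ h
    simp only [mem_filter, mem_positiveTriples] at h ⊢
    exact ⟨by omega, h.2⟩
  · rintro ⟨a, b, c⟩ - ⟨a', b', c'⟩ - h
    simp only [Prod.mk.injEq] at h ⊢
    tauto
  · rintro ⟨a, b, c⟩ h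
    simp only [mem_filter, mem_positiveTriples] at h
    refine ⟨(c, a, b), ?_, rfl⟩
    simp only [mem_filter, mem_positiveTriples]
    exact ⟨by omega, h.2⟩

lemma card_filter_or_rotate_le (n : ℕ) (P : ℕ × ℕ × ℕ → Prop) [DecidablePred P] :
    #{t ∈ positiveTriples n | P t ∨ P (t.2.1, t.2.2, t.1) ∨ P (t.2.2, t.1, t.2.1)} ≤
      3 * #{t ∈ positiveTriples n | P t} := by
  have h1 : #{t ∈ positiveTriples n | P (t.2.1, t.2.2, t.1)} = #{t ∈ positiveTriples n | P t} :=
    card_filter_rotate n P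
  have h2 : #{t ∈ positiveTriples n | P (t.2.2, t.1, t.2.1)} =
      #{t ∈ positiveTriples n | P (t.2.1, t.2.2, t.1)} :=
    card_filter_rotate n fun t => P (t.2.1, t.2.2, t.1)
  rw [filter_or, filter_or]
  have h3 := card_union_le {t ∈ positiveTriples n | P t}
    ({t ∈ positiveTriples n | P (t.2.1, t.2.2, t.1)} ∪
      {t ∈ positiveTriples n | P (t.2.2, t.1, t.2.1)})
  have h4 := card_union_le {t ∈ positiveTriples n | P (t.2.1, t.2.2, t.1)}
    {t ∈ positiveTriples n | P (t.2.2, t.1, t.2.1)}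
  exact h3.trans (by omega)

/-- A property of triples that determines an injective invariant in `U` holds at most `#U`
times. -/
lemma card_filter_fst_snd_le (n : ℕ) (P : ℕ × ℕ × ℕ → Prop) [DecidablePred P]
    (U : Finset (ℕ × ℕ)) (h : ∀ a b c, 0 < a → 0 < b → 0 < c → a + b + c = n → P (a, b, c) →
      (a, b) ∈ U) : #{t ∈ positiveTriples n | P t} ≤ #U := by
  refine card_le_card_of_injOn (fun t => (t.1, t.2.1)) ?_ ?_
  · rintro ⟨a, b, c⟩ ht
    rw [mem_coe, mem_filter, mem_positiveTriples] at ht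
    exact h a b c ht.1.1 ht.1.2.1 ht.1.2.2.1 ht.1.2.2.2 ht.2
  · rintro ⟨a, b, c⟩ ht ⟨a', b', c'⟩ ht' heq
    rw [mem_coe, mem_filter, mem_positiveTriples] at ht ht'
    simp only [Prod.mk.injEq] at heq ⊢
    omega

/-- The number of triples with greatest common divisor one. -/
lemma card_coprime_triples_ge {n : ℕ} (hn : n ≠ 0) :
    (n : ℝ) ^ 2 * ∏ p ∈ n.primeFactors, (1 - 1 / (p : ℝ) ^ 2) ≤
      2 * #{t ∈ positiveTriples n | Nat.gcd (Nat.gcd t.1 t.2.1) t.2.2 = 1} + 3 * n := by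
  rw [← card_filter_gcd_eq_one hn]
  set X := {t ∈ positiveTriples n | Nat.gcd (Nat.gcd t.1 t.2.1) t.2.2 = 1} with hX
  have hsub : {t ∈ range n ×ˢ range n | Nat.gcd (Nat.gcd t.1 t.2) n = 1} ⊆
      (X.image (fun t => (t.1, t.2.1)) ∪ X.image (fun t => (n - t.1, n - t.2.1))) ∪
      ((range n).image (fun k => (0, k)) ∪ (range n).image (fun k => (k, 0)) ∪
        (range n).image (fun k => (k, n - k))) := by
    rintro ⟨a, b⟩ h
    simp only [mem_filter, mem_product, mem_range] at h
    obtain ⟨⟨ha, hb⟩, hg⟩ := h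
    simp only [mem_union, mem_image, mem_range, Prod.mk.injEq, Prod.exists]
    rcases Nat.eq_zero_or_pos a with rfl | ha0
    · exact Or.inr (Or.inl (Or.inl ⟨b, hb, rfl, rfl⟩))
    rcases Nat.eq_zero_or_pos b with rfl | hb0
    · exact Or.inr (Or.inl (Or.inr ⟨a, ha, rfl, rfl⟩))
    rcases lt_trichotomy (a + b) n with h | h | h
    · refine Or.inl (Or.inl ⟨a, b, n - a - b, ?_, rfl, rfl⟩)
      rw [hX, mem_filter, mem_positiveTriples]
      refine ⟨by omega, ?_⟩
      rw [← hg]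
      have hs : n = (n - a - b) + (a + b) := by omega
      conv_rhs => rw [hs]
      rw [Nat.gcd_comm _ (_ + _), Nat.gcd_add_right_left_of_dvd _
        (dvd_add (Nat.gcd_dvd_left a b) (Nat.gcd_dvd_right a b)), Nat.gcd_comm]
    · exact Or.inr (Or.inr ⟨a, ha, rfl, by omega⟩)
    · refine Or.inl (Or.inr ⟨n - a, n - b, a + b - n, ?_, by omega, by omega⟩)
      rw [hX, mem_filter, mem_positiveTriples]
      refine ⟨by omega, ?_⟩
      rw [← Nat.dvd_one, ← hg]
      set e := Nat.gcd (Nat.gcd (n - a) (n - b)) (a + b - n)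
      have e1 : e ∣ n - a := (Nat.gcd_dvd_left _ _).trans (Nat.gcd_dvd_left _ _)
      have e2 : e ∣ n - b := (Nat.gcd_dvd_left _ _).trans (Nat.gcd_dvd_right _ _)
      have e3 : e ∣ a + b - n := Nat.gcd_dvd_right _ _
      have e4 : e ∣ n := by
        have : n = (n - a) + (n - b) + (a + b - n) := by omega
        rw [this]; exact dvd_add (dvd_add e1 e2) e3
      refine Nat.dvd_gcd (Nat.dvd_gcd ?_ ?_) e4
      · have : a = n - (n - a) := by omega
        rw [this]; exact Nat.dvd_sub e4 e1
      · have : b = n - (n - b) := by omega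
        rw [this]; exact Nat.dvd_sub e4 e2
  have h1 := card_le_card hsub
  have h2 := card_union_le (X.image (fun t => (t.1, t.2.1)) ∪
    X.image (fun t => (n - t.1, n - t.2.1)))
    ((range n).image (fun k => (0, k)) ∪ (range n).image (fun k => (k, 0)) ∪
        (range n).image (fun k => (k, n - k)))
  have h3 := card_union_le (X.image (fun t => (t.1, t.2.1)))
    (X.image (fun t => (n - t.1, n - t.2.1)))
  have h4 := card_union_le ((range n).image (fun k => ((0 : ℕ), k)) ∪
    (range n).image (fun k => (k, 0))) ((range n).image (fun k => (k, n - k)))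
  have h5 := card_union_le ((range n).image (fun k => ((0 : ℕ), k)))
    ((range n).image (fun k => (k, 0)))
  have h6 : #(X.image (fun t => (t.1, t.2.1))) ≤ #X := card_image_le
  have h7 : #(X.image (fun t => (n - t.1, n - t.2.1))) ≤ #X := card_image_le
  have h8 : #((range n).image (fun k => ((0 : ℕ), k))) ≤ #(range n) := card_image_le
  have h9 : #((range n).image (fun k => (k, 0))) ≤ #(range n) := card_image_le
  have h10 : #((range n).image (fun k => (k, n - k))) ≤ #(range n) := card_image_le
  rw [card_range] at h8 h9 h10
  have : #{t ∈ range n ×ˢ range n | Nat.gcd (Nat.gcd t.1 t.2) n = 1} ≤ 2 * #X + 3 * n := by omega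
  exact_mod_cast this

lemma two_mul_card_filter_add_lt {n : ℕ} {K L : Finset ℕ} (hK : ∀ k ∈ K, k < n ∧ n - k ∈ K)
    (hL : ∀ l ∈ L, l < n ∧ n - l ∈ L) (hKL : K ⊆ L) :
    2 * #{t ∈ K ×ˢ L | t.1 + t.2 < n} + #K = #K * #L := by
  have h1 : #{t ∈ K ×ˢ L | t.1 + t.2 < n} = #{t ∈ K ×ˢ L | n < t.1 + t.2} := by
    refine card_nbij' (fun t => (n - t.1, n - t.2)) (fun t => (n - t.1, n - t.2)) ?_ ?_ ?_ ?_
    all_goals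
      rintro ⟨k, l⟩ h
      simp only [coe_filter, mem_product, Set.mem_ofPred_eq, Prod.mk.injEq] at h ⊢
      have h1 := hK k h.1.1
      have h2 := hL l h.1.2
    · exact ⟨⟨h1.2, h2.2⟩, by omega⟩
    · exact ⟨⟨h1.2, h2.2⟩, by omega⟩
    · omega
    · omega
  have h2 : #{t ∈ K ×ˢ L | t.1 + t.2 = n} = #K := by
    refine card_nbij' (fun t => t.1) (fun k => (k, n - k)) ?_ ?_ ?_ ?_
    · rintro ⟨k, l⟩ h
      simp only [coe_filter, mem_product, Set.mem_ofPred_eq] at h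
      exact h.1.1
    · intro k hk
      have := hK k hk
      simp only [coe_filter, mem_product, Set.mem_ofPred_eq]
      exact ⟨⟨hk, hKL this.2⟩, by omega⟩
    · rintro ⟨k, l⟩ h
      simp only [coe_filter, mem_product, Set.mem_ofPred_eq, Prod.mk.injEq, true_and] at h ⊢
      omega
    · intro k hk
      rfl
  have h3 := card_filter_add_card_filter_not (s := K ×ˢ L) (p := fun t => t.1 + t.2 < n)
  have h4 := card_filter_add_card_filter_not (s := {t ∈ K ×ˢ L | ¬ t.1 + t.2 < n})
    (p := fun t => t.1 + t.2 = n)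
  rw [filter_filter, filter_filter] at h4
  have h5 : {t ∈ K ×ˢ L | ¬ t.1 + t.2 < n ∧ t.1 + t.2 = n} = {t ∈ K ×ˢ L | t.1 + t.2 = n} :=
    filter_congr fun t _ => by omega
  have h6 : {t ∈ K ×ˢ L | ¬ t.1 + t.2 < n ∧ ¬ t.1 + t.2 = n} = {t ∈ K ×ˢ L | n < t.1 + t.2} :=
    filter_congr fun t _ => by omega
  rw [h5, h6] at h4
  rw [card_product] at h3
  omega

lemma card_filter_fst_snd_mem {n : ℕ} {K L : Finset ℕ} (hK : ∀ k ∈ K, 0 < k)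
    (hL : ∀ l ∈ L, 0 < l) :
    #{t ∈ positiveTriples n | t.1 ∈ K ∧ t.2.1 ∈ L} = #{t ∈ K ×ˢ L | t.1 + t.2 < n} := by
  refine card_nbij' (fun t => (t.1, t.2.1)) (fun t => (t.1, t.2, n - t.1 - t.2)) ?_ ?_ ?_ ?_
  · rintro ⟨a, b, c⟩ h
    simp only [coe_filter, mem_product, Set.mem_ofPred_eq, mem_positiveTriples] at h ⊢
    exact ⟨h.2, by omega⟩
  · rintro ⟨a, b⟩ h
    simp only [coe_filter, mem_product, Set.mem_ofPred_eq, mem_positiveTriples] at h ⊢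
    have := hK a h.1.1
    have := hL b h.1.2
    exact ⟨by omega, h.1⟩
  · rintro ⟨a, b, c⟩ h
    simp only [coe_filter, Set.mem_ofPred_eq, mem_positiveTriples, Prod.mk.injEq, true_and] at h ⊢
    omega
  · rintro ⟨a, b⟩ h
    rfl

/-- The number of triples having a part in a symmetric set. -/
lemma two_mul_card_triples_mem_le {n : ℕ} {K : Finset ℕ}
    (hK : ∀ k ∈ K, 0 < k ∧ k < n ∧ n - k ∈ K) :
    2 * #{t ∈ positiveTriples n | t.1 ∈ K ∨ t.2.1 ∈ K ∨ t.2.2 ∈ K} + 2 * (#K * #K) ≤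
      3 * (#K * (n - 2)) + 2 * #K := by
  classical
  obtain ⟨T, hT⟩ : ∃ T, T = positiveTriples n := ⟨_, rfl⟩
  set P1 := {t ∈ T | t.1 ∈ K}
  set P2 := {t ∈ T | t.2.1 ∈ K}
  set P3 := {t ∈ T | t.2.2 ∈ K}
  have hL : ∀ l ∈ Ioo 0 n, l < n ∧ n - l ∈ Ioo 0 n := by
    intro l hl
    simp only [mem_Ioo] at hl ⊢
    omega
  have hKL : K ⊆ Ioo 0 n := fun k hk => mem_Ioo.2 ⟨(hK k hk).1, (hK k hk).2.1⟩
  have h1 := two_mul_card_filter_add_lt (fun k hk => (hK k hk).2) hL hKL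
  have h2 := two_mul_card_filter_add_lt (fun k hk => (hK k hk).2) (fun k hk => (hK k hk).2)
    Subset.rfl
  rw [← card_filter_fst_snd_mem (fun k hk => (hK k hk).1) (fun l hl => (mem_Ioo.1 hl).1), ← hT] at h1
  rw [← card_filter_fst_snd_mem (fun k hk => (hK k hk).1) (fun k hk => (hK k hk).1), ← hT] at h2
  rw [← hT]
  have e1 : {t ∈ T | t.1 ∈ K ∧ t.2.1 ∈ Ioo 0 n} = P1 := by
    refine filter_congr ?_
    rintro ⟨a, b, c⟩ h
    rw [hT, mem_positiveTriples] at h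
    simp only [mem_Ioo, and_iff_left_iff_imp]
    omega
  rw [e1] at h1
  have e2 : #P2 = #P1 := by simp only [P1, P2, hT]; exact card_filter_rotate n fun t => t.1 ∈ K
  have e3 : #P3 = #P2 := by simp only [P2, P3, hT]; exact card_filter_rotate n fun t => t.2.1 ∈ K
  have e4 : P1 ∩ P2 = {t ∈ T | t.1 ∈ K ∧ t.2.1 ∈ K} := (filter_and ..).symm
  have e5 : P3 ∩ P1 = {t ∈ T | t.2.2 ∈ K ∧ t.1 ∈ K} := (filter_and ..).symm
  have e6 : #{t ∈ T | t.2.2 ∈ K ∧ t.1 ∈ K} = #{t ∈ T | t.2.1 ∈ K ∧ t.2.2 ∈ K} :=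
    hT ▸ card_filter_rotate n fun t => t.2.1 ∈ K ∧ t.2.2 ∈ K
  have e7 : #{t ∈ T | t.2.1 ∈ K ∧ t.2.2 ∈ K} = #{t ∈ T | t.1 ∈ K ∧ t.2.1 ∈ K} :=
    hT ▸ card_filter_rotate n fun t => t.1 ∈ K ∧ t.2.1 ∈ K
  have h3 := card_union_add_card_inter P1 P2
  have h4 := card_union_add_card_inter P3 (P1 ∪ P2)
  have h5 : #(P3 ∩ P1) ≤ #(P3 ∩ (P1 ∪ P2)) :=
    card_le_card (inter_subset_inter Subset.rfl subset_union_left)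
  have h6 : {t ∈ T | t.1 ∈ K ∨ t.2.1 ∈ K ∨ t.2.2 ∈ K} = P3 ∪ (P1 ∪ P2) := by
    rw [← filter_or, ← filter_or]
    exact filter_congr fun t _ => by tauto
  rw [h6]
  rw [e4] at h3
  replace h5 : #{t ∈ T | t.1 ∈ K ∧ t.2.1 ∈ K} ≤ #(P3 ∩ (P1 ∪ P2)) :=
    le_of_eq_of_le ((e6.trans e7).symm.trans (congrArg _ e5.symm)) h5
  have hn : #(Ioo 0 n) = n - 1 := by simp
  rw [hn] at h1
  rcases K.eq_empty_or_nonempty with h0 | ⟨k, hk⟩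
  · rw [h0] at h1 h2 ⊢
    simp only [card_empty] at h1 h2 ⊢
    omega
  · have hn2 : n - 1 = (n - 2) + 1 := by have := hK k hk; omega
    rw [hn2, mul_add, mul_one] at h1
    omega

lemma card_filter_fst_lt_le (n : ℕ) {r : ℝ} (hr : 0 ≤ r)
    [DecidablePred fun t : ℕ × ℕ × ℕ => (t.1 : ℝ) < r] :
    (#{t ∈ positiveTriples n | (t.1 : ℝ) < r} : ℝ) ≤ r * n := by
  have h := card_filter_fst_snd_le n (fun t => (t.1 : ℝ) < r) (Ioc 0 ⌊r⌋₊ ×ˢ range n) (by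
    intro a b c ha hb hc hn h
    simp only [mem_product, mem_Ioc, mem_range]
    exact ⟨⟨ha, Nat.le_floor h.le⟩, by omega⟩)
  rw [card_product, Nat.card_Ioc, card_range, Nat.sub_zero] at h
  calc (#{t ∈ positiveTriples n | (t.1 : ℝ) < r} : ℝ) ≤ ((⌊r⌋₊ * n : ℕ) : ℝ) := by
        exact_mod_cast h
    _ ≤ r * n := by push_cast; gcongr; exact Nat.floor_le hr

lemma card_pairs_sum_le (N : ℕ) :
    2 * #{t ∈ Ioc 0 N ×ˢ Ioc 0 N | t.1 + t.2 ≤ N} ≤ N * N := by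
  have h1 : #{t ∈ Ioc 0 N ×ˢ Ioc 0 N | t.1 + t.2 ≤ N} ≤
      #{t ∈ Ioc 0 N ×ˢ Ioc 0 N | ¬ t.1 + t.2 ≤ N} := by
    refine card_le_card_of_injOn (fun t => (N + 1 - t.1, N + 1 - t.2)) ?_ ?_
    · rintro ⟨a, b⟩ h
      simp only [coe_filter, mem_product, mem_Ioc, Set.mem_ofPred_eq] at h ⊢
      omega
    · rintro ⟨a, b⟩ h ⟨a', b'⟩ h' heq
      simp only [coe_filter, mem_product, mem_Ioc, Set.mem_ofPred_eq, Prod.mk.injEq] at h h' heq ⊢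
      omega
  have h2 := card_filter_add_card_filter_not (s := Ioc 0 N ×ˢ Ioc 0 N)
    (p := fun t => t.1 + t.2 ≤ N)
  rw [card_product, Nat.card_Ioc, Nat.sub_zero] at h2
  omega

lemma card_filter_lt_gcd_le (n : ℕ) {D : ℕ} (hD : D ≠ 0) (hDn : D ≤ n) :
    (#{t ∈ positiveTriples n | D < Nat.gcd t.1 t.2.1} : ℝ) ≤ n ^ 2 / (2 * D) := by
  classical
  have h := card_filter_fst_snd_le n (fun t => D < Nat.gcd t.1 t.2.1)
    ((Ioc D n).biUnion fun d => ({t ∈ Ioc 0 (n / d) ×ˢ Ioc 0 (n / d) | t.1 + t.2 ≤ n / d}).image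
      fun t => (d * t.1, d * t.2)) (by
    intro a b c ha hb hc hn h
    simp only at h
    have hd : 0 < Nat.gcd a b := Nat.gcd_pos_of_pos_left _ ha
    obtain ⟨k, hk⟩ := Nat.gcd_dvd_left a b
    obtain ⟨l, hl⟩ := Nat.gcd_dvd_right a b
    set d := Nat.gcd a b
    have hk0 : 0 < k := Nat.pos_of_ne_zero (by rintro rfl; omega)
    have hl0 : 0 < l := Nat.pos_of_ne_zero (by rintro rfl; omega)
    have hkl : k + l ≤ n / d := by
      rw [Nat.le_div_iff_mul_le hd, mul_comm, mul_add]
      omega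
    simp only [mem_biUnion, mem_Ioc, mem_image, mem_filter, mem_product, Prod.exists,
      Prod.mk.injEq]
    refine ⟨d, ⟨h, ?_⟩, k, l, ⟨⟨⟨hk0, by omega⟩, hl0, by omega⟩, hkl⟩, hk.symm, hl.symm⟩
    have := Nat.le_of_dvd ha (Nat.gcd_dvd_left a b)
    omega)
  have h2 := h.trans card_biUnion_le
  have hr : (#{t ∈ positiveTriples n | D < Nat.gcd t.1 t.2.1} : ℝ) ≤
      ∑ d ∈ Ioc D n, (n : ℝ) ^ 2 / 2 * ((d : ℝ) ^ 2)⁻¹ := by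
    refine le_trans (Nat.cast_le.2 h2) ?_
    push_cast
    refine sum_le_sum fun d hd => ?_
    have h3 := card_pairs_sum_le (n / d)
    have h4 : #(({t ∈ Ioc 0 (n / d) ×ˢ Ioc 0 (n / d) | t.1 + t.2 ≤ n / d}).image
      fun t => (d * t.1, d * t.2)) ≤ #({t ∈ Ioc 0 (n / d) ×ˢ Ioc 0 (n / d) | t.1 + t.2 ≤ n / d}) :=
      card_image_le
    have h5 : 2 * (#(({t ∈ Ioc 0 (n / d) ×ˢ Ioc 0 (n / d) | t.1 + t.2 ≤ n / d}).image
      fun t => (d * t.1, d * t.2)) : ℝ) ≤ (n / d : ℕ) * (n / d : ℕ) := by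
      exact_mod_cast (Nat.mul_le_mul_left 2 h4).trans h3
    have h6 : ((n / d : ℕ) : ℝ) ≤ n / d := Nat.cast_div_le
    have h7 : ((n / d : ℕ) : ℝ) * (n / d : ℕ) ≤ (n / d : ℝ) * (n / d) := by gcongr
    have h8 : (n : ℝ) ^ 2 / 2 * ((d : ℝ) ^ 2)⁻¹ = (n / d : ℝ) * (n / d) / 2 := by
      field_simp
    rw [h8]
    linarith
  rw [← mul_sum] at hr
  have h9 := sum_Ioc_inv_sq_le_sub (α := ℝ) hD hDn
  have hD0 : (0 : ℝ) < D := by exact_mod_cast Nat.pos_of_ne_zero hD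
  calc _ ≤ _ := hr
    _ ≤ (n : ℝ) ^ 2 / 2 * (D : ℝ)⁻¹ := by
        gcongr
        have : (0 : ℝ) ≤ (n : ℝ)⁻¹ := by positivity
        linarith
    _ = _ := by field_simp

lemma card_divisors_le_two_mul_sqrt (n : ℕ) : #n.divisors ≤ 2 * n.sqrt := by
  classical
  have h : n.divisors ⊆ Ioc 0 n.sqrt ∪ (Ioc 0 n.sqrt).image fun d => n / d := by
    intro d hd
    obtain ⟨⟨e, rfl⟩, hn⟩ := Nat.mem_divisors.1 hd
    have hd0 : 0 < d := Nat.pos_of_ne_zero (by rintro rfl; simp at hn)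
    have he0 : 0 < e := Nat.pos_of_ne_zero (by rintro rfl; simp at hn)
    simp only [mem_union, mem_Ioc, mem_image]
    rcases le_total d e with h | h
    · exact Or.inl ⟨hd0, Nat.le_sqrt.2 (Nat.mul_le_mul_left d h)⟩
    · exact Or.inr ⟨e, ⟨he0, Nat.le_sqrt.2 (Nat.mul_le_mul_right e h)⟩,
        Nat.mul_div_cancel _ he0⟩
  have h1 := (card_le_card h).trans (card_union_le _ _)
  have h2 : #((Ioc 0 n.sqrt).image fun d => n / d) ≤ #(Ioc 0 n.sqrt) := card_image_le
  rw [Nat.card_Ioc] at h1 h2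
  omega

lemma card_filter_isImprimitiveTriple_le (n : ℕ)
    [DecidablePred fun t : ℕ × ℕ × ℕ => IsImprimitiveTriple t.1 t.2.1 t.2.2] :
    #{t ∈ positiveTriples n | IsImprimitiveTriple t.1 t.2.1 t.2.2} ≤ 2 * n.sqrt * n := by
  classical
  have h := card_filter_fst_snd_le n (fun t => IsImprimitiveTriple t.1 t.2.1 t.2.2)
    (n.divisors.biUnion fun β => (range (n / β) ×ˢ range β).image
      fun t => (t.1 * t.2, t.1 * β - t.1 * t.2)) (by
    rintro a b c ha hb hc hn ⟨β, m, h1, h2, h3, h4, j, hj⟩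
    simp only at h1 h2 h3 h4 hj
    rw [hn] at h3
    simp only [mem_biUnion, mem_image, mem_product, mem_range, Prod.exists, Prod.mk.injEq]
    have hm : 0 < m := Nat.pos_of_ne_zero (by rintro rfl; omega)
    refine ⟨β, Nat.mem_divisors.2 ⟨h3, by omega⟩, m, j, ⟨?_, ?_⟩, hj.symm, ?_⟩
    · exact (Nat.lt_div_iff_mul_lt' h3 m).2 (by rw [mul_comm]; omega)
    · exact Nat.lt_of_mul_lt_mul_left (a := m) (by omega)
    · omega)
  refine h.trans (card_biUnion_le.trans ?_)
  calc ∑ β ∈ n.divisors, #((range (n / β) ×ˢ range β).image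
        fun t => (t.1 * t.2, t.1 * β - t.1 * t.2)) ≤ ∑ β ∈ n.divisors, n := by
        refine sum_le_sum fun β hβ => card_image_le.trans ?_
        rw [card_product, card_range, card_range]
        exact Nat.div_mul_le_self n β
    _ ≤ 2 * n.sqrt * n := by
        rw [sum_const, smul_eq_mul]
        exact Nat.mul_le_mul_right _ (card_divisors_le_two_mul_sqrt n)

lemma IsImprimitiveTriple.swap {a b c : ℕ} (h : IsImprimitiveTriple a b c) :
    IsImprimitiveTriple b a c := by
  obtain ⟨β, m, h1, h2, h3, h4, h5⟩ := h
  refine ⟨β, m, h1, by omega, ?_, by omega, ?_⟩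
  · rwa [add_comm b a]
  · exact (Nat.dvd_add_right h5).1 (h4 ▸ dvd_mul_right m β)

/-- Triples with all three parts close to `n / 3`. -/
lemma card_filter_balanced_le {n : ℕ} {r : ℝ} (hr0 : 0 ≤ r) (hr : r ≤ n)
    [DecidablePred fun t : ℕ × ℕ × ℕ =>
      (n : ℝ) < 3 * t.1 + r ∧ (n : ℝ) < 3 * t.2.1 + r ∧ (n : ℝ) < 3 * t.2.2 + r] :
    (#{t ∈ positiveTriples n | (n : ℝ) < 3 * t.1 + r ∧ (n : ℝ) < 3 * t.2.1 + r ∧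
      (n : ℝ) < 3 * t.2.2 + r} : ℝ) ≤ (r + 1) ^ 2 := by
  set I := Ioc ⌊(n - r) / 3⌋₊ ⌊(n + 2 * r) / 3⌋₊
  have h := card_filter_fst_snd_le n (fun t => (n : ℝ) < 3 * t.1 + r ∧ (n : ℝ) < 3 * t.2.1 + r ∧
      (n : ℝ) < 3 * t.2.2 + r) (I ×ˢ I) (by
    intro a b c ha hb hc hn ⟨h1, h2, h3⟩
    simp only at h1 h2 h3
    have hn' : (a + b + c : ℝ) = n := by exact_mod_cast hn
    have hnr : 0 ≤ ((n : ℝ) - r) / 3 := by linarith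
    simp only [mem_product, I, mem_Ioc]
    refine ⟨⟨?_, ?_⟩, ?_, ?_⟩
    · rw [Nat.floor_lt hnr]; linarith
    · apply Nat.le_floor; linarith
    · rw [Nat.floor_lt hnr]; linarith
    · apply Nat.le_floor; linarith)
  have hI : (#I : ℝ) ≤ r + 1 := by
    have e1 : (⌊((n : ℝ) + 2 * r) / 3⌋₊ : ℝ) ≤ (n + 2 * r) / 3 := Nat.floor_le (by positivity)
    have e2 : ((n : ℝ) - r) / 3 < ⌊((n : ℝ) - r) / 3⌋₊ + 1 := Nat.lt_floor_add_one _
    have e3 : ⌊((n : ℝ) - r) / 3⌋₊ ≤ ⌊((n : ℝ) + 2 * r) / 3⌋₊ := by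
      apply Nat.floor_le_floor; linarith
    rw [Nat.card_Ioc, Nat.cast_sub e3]
    linarith
  rw [card_product] at h
  calc _ ≤ (#I * #I : ℝ) := by exact_mod_cast h
    _ ≤ (r + 1) * (r + 1) := by gcongr
    _ = _ := by ring

/-- A symmetric set of part sizes meeting all good triples meets most coprime triples. -/
lemma coprime_triples_le_of_forall_good {n D : ℕ} {x : ℝ} (hx : 9 ≤ x) (hxn : x ^ 4 = n)
    (hD : 4 * D ≤ 3 * x) (hD' : 3 * x ≤ 4 * (D + 1)) {K : Finset ℕ}
    (h : ∀ a b c, a + b + c = n → IsGoodTriple D x a b c → a ∈ K ∨ b ∈ K ∨ c ∈ K) :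
    6 * zeta2 n * n ^ 2 ≤
      #{t ∈ positiveTriples n | t.1 ∈ K ∨ t.2.1 ∈ K ∨ t.2.2 ∈ K} +
        (3.464 * x ^ 7 + 12 * x ^ 6) := by
  classical
  have hx0 : 0 < x := by linarith
  have hx2 : 81 ≤ x ^ 2 := by nlinarith
  have hx42 : 81 * x ^ 2 ≤ x ^ 4 := by nlinarith
  have hn0 : n ≠ 0 := by
    rintro rfl
    norm_num at hxn; linarith
  have hD0 : 0 < (D : ℝ) := by linarith
  have hDn : D ≤ n := by
    have : (D : ℝ) ≤ n := by rw [← hxn]; nlinarith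
    exact_mod_cast this
  set T := positiveTriples n
  set U := {t ∈ T | t.1 ∈ K ∨ t.2.1 ∈ K ∨ t.2.2 ∈ K}
  set P1 : ℕ × ℕ × ℕ → Prop := fun t => (t.1 : ℝ) < 2 / 5 * x ^ 3 with hP1
  set P2 : ℕ × ℕ × ℕ → Prop := fun t => D < Nat.gcd t.1 t.2.1 with hP2
  set P3 : ℕ × ℕ × ℕ → Prop := fun t => IsImprimitiveTriple t.1 t.2.1 t.2.2 with hP3
  set P4 : ℕ × ℕ × ℕ → Prop := fun t => (n : ℝ) < 3 * t.1 + 4 * x ^ 2 ∧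
    (n : ℝ) < 3 * t.2.1 + 4 * x ^ 2 ∧ (n : ℝ) < 3 * t.2.2 + 4 * x ^ 2 with hP4
  have hsub : {t ∈ T | Nat.gcd (Nat.gcd t.1 t.2.1) t.2.2 = 1} ⊆ U ∪
      ({t ∈ T | P1 t ∨ P1 (t.2.1, t.2.2, t.1) ∨ P1 (t.2.2, t.1, t.2.1)} ∪
      ({t ∈ T | P2 t ∨ P2 (t.2.1, t.2.2, t.1) ∨ P2 (t.2.2, t.1, t.2.1)} ∪
      ({t ∈ T | P3 t ∨ P3 (t.2.1, t.2.2, t.1) ∨ P3 (t.2.2, t.1, t.2.1)} ∪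
      {t ∈ T | P4 t}))) := by
    rintro ⟨a, b, c⟩ ht
    rw [mem_filter] at ht
    obtain ⟨htT, hg⟩ := ht
    simp only [mem_union, mem_filter, htT, true_and, U]
    by_contra! hcon
    obtain ⟨hU, h1, h2, h3, h4⟩ := hcon
    simp only [hP1, not_lt] at h1
    simp only [hP2, not_lt] at h2
    simp only [hP4] at h4
    rcases h a b c (mem_positiveTriples.1 htT).2.2.2
      { le_fst := h1.1
        le_snd := h1.2.1
        le_trd := h1.2.2
        gcd_fst_snd := h2.1
        gcd_fst_trd := Nat.gcd_comm a c ▸ h2.2.2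
        gcd_snd_trd := h2.2.1
        gcd_eq_one := hg
        fst_snd := h3.1
        fst_trd := fun h => h3.2.2 h.swap
        snd_trd := h3.2.1
        exists_small := by
          rw [hxn]
          by_contra! hs
          exact h4 ⟨hs.1, hs.2.1, hs.2.2⟩ } with h' | h' | h'
    · exact hU.1 h'
    · exact hU.2.1 h'
    · exact hU.2.2 h'
  have b1 := card_filter_or_rotate_le n P1
  have b2 := card_filter_or_rotate_le n P2
  have b3 := card_filter_or_rotate_le n P3
  have c1 : (#{t ∈ T | P1 t} : ℝ) ≤ 2 / 5 * x ^ 3 * n := card_filter_fst_lt_le n (by positivity)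
  have c2 : (#{t ∈ T | P2 t} : ℝ) ≤ n ^ 2 / (2 * D) :=
    card_filter_lt_gcd_le n (by exact_mod_cast hD0.ne') hDn
  have c3 : #{t ∈ T | P3 t} ≤ 2 * n.sqrt * n := card_filter_isImprimitiveTriple_le n
  have c4 : (#{t ∈ T | P4 t} : ℝ) ≤ (4 * x ^ 2 + 1) ^ 2 :=
    card_filter_balanced_le (by positivity) (by rw [← hxn]; linarith)
  have hcard := card_le_card hsub
  have u1 := card_union_le U ({t ∈ T | P1 t ∨ P1 (t.2.1, t.2.2, t.1) ∨ P1 (t.2.2, t.1, t.2.1)} ∪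
      ({t ∈ T | P2 t ∨ P2 (t.2.1, t.2.2, t.1) ∨ P2 (t.2.2, t.1, t.2.1)} ∪
      ({t ∈ T | P3 t ∨ P3 (t.2.1, t.2.2, t.1) ∨ P3 (t.2.2, t.1, t.2.1)} ∪
      {t ∈ T | P4 t})))
  have u2 := card_union_le {t ∈ T | P1 t ∨ P1 (t.2.1, t.2.2, t.1) ∨ P1 (t.2.2, t.1, t.2.1)}
      ({t ∈ T | P2 t ∨ P2 (t.2.1, t.2.2, t.1) ∨ P2 (t.2.2, t.1, t.2.1)} ∪
      ({t ∈ T | P3 t ∨ P3 (t.2.1, t.2.2, t.1) ∨ P3 (t.2.2, t.1, t.2.1)} ∪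
      {t ∈ T | P4 t}))
  have u3 := card_union_le {t ∈ T | P2 t ∨ P2 (t.2.1, t.2.2, t.1) ∨ P2 (t.2.2, t.1, t.2.1)}
      ({t ∈ T | P3 t ∨ P3 (t.2.1, t.2.2, t.1) ∨ P3 (t.2.2, t.1, t.2.1)} ∪
      {t ∈ T | P4 t})
  have u4 := card_union_le {t ∈ T | P3 t ∨ P3 (t.2.1, t.2.2, t.1) ∨ P3 (t.2.2, t.1, t.2.1)}
      {t ∈ T | P4 t}
  have htot : (#{t ∈ T | Nat.gcd (Nat.gcd t.1 t.2.1) t.2.2 = 1} : ℝ) ≤ #U +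
      (3 * #{t ∈ T | P1 t} + 3 * #{t ∈ T | P2 t} + 3 * #{t ∈ T | P3 t} + #{t ∈ T | P4 t}) := by
    have := hcard.trans <| u1.trans <| Nat.add_le_add_left (u2.trans <| Nat.add_le_add b1 <|
      u3.trans <| Nat.add_le_add b2 <| u4.trans <| Nat.add_le_add_right b3 _) _
    have := (Nat.cast_le (α := ℝ)).2 this
    push_cast at this
    linarith
  have hsqrt : (n.sqrt : ℝ) ≤ x ^ 2 := by
    have h1 : ((n.sqrt : ℕ) : ℝ) ^ 2 ≤ (x ^ 2) ^ 2 := by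
      have : ((n.sqrt ^ 2 : ℕ) : ℝ) ≤ n := by exact_mod_cast Nat.sqrt_le' n
      push_cast at this
      rw [← pow_mul, hxn]; exact this
    exact le_of_sq_le_sq h1 (by positivity)
  have c3' : (#{t ∈ T | P3 t} : ℝ) ≤ 2 * x ^ 6 := by
    calc (#{t ∈ T | P3 t} : ℝ) ≤ 2 * n.sqrt * n := by exact_mod_cast c3
      _ ≤ 2 * x ^ 2 * x ^ 4 := by rw [hxn]; gcongr
      _ = _ := by ring
  have c2' : (#{t ∈ T | P2 t} : ℝ) ≤ x ^ 8 / (2 * (3 / 4 * x - 1)) := by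
    refine c2.trans ?_
    have e : (n : ℝ) ^ 2 = x ^ 8 := by rw [← hxn]; ring
    rw [e]
    have : 0 < 3 / 4 * x - 1 := by linarith
    gcongr
    linarith
  have c2'' : x ^ 8 / (2 * (3 / 4 * x - 1)) ≤ 2 / 3 * x ^ 7 + 1.05 * x ^ 6 := by
    rw [div_le_iff₀ (by linarith)]
    have : 0 ≤ x ^ 6 * ((1.5 * 1.05 - 4 / 3) * x - 2.1) := by
      apply mul_nonneg (by positivity); linarith
    linarith
  have hcop : _ ≤ 2 * (#{t ∈ T | Nat.gcd (Nat.gcd t.1 t.2.1) t.2.2 = 1} : ℝ) + _ :=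
    card_coprime_triples_ge hn0
  have hz : 6 * zeta2 n * n ^ 2 =
      ((n : ℝ) ^ 2 * ∏ p ∈ n.primeFactors, (1 - 1 / (p : ℝ) ^ 2)) / 2 := by
    rw [zeta2]; ring
  rw [hz]
  have e7 : 9 * x ^ 6 ≤ x ^ 7 := by rw [pow_succ x 6, mul_comm]; gcongr
  have e6 : 81 * x ^ 4 ≤ x ^ 6 := by
    have : x ^ 6 = x ^ 2 * x ^ 4 := by ring
    rw [this]; gcongr
  have c1' : (#{t ∈ T | P1 t} : ℝ) ≤ 2 / 5 * x ^ 7 := by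
    refine c1.trans (le_of_eq ?_)
    rw [← hxn]; ring
  have c4' : (4 * x ^ 2 + 1) ^ 2 = 16 * x ^ 4 + 8 * x ^ 2 + 1 := by ring
  rw [← hxn] at hcop ⊢
  linarith

/-- The numerical content of the lower bound. -/
lemma lower_bound_of_count {N s ζ f x : ℝ} (hN : x ^ 4 = N) (hx : 9 ≤ x) (hs : 0 ≤ s)
    (hζ0 : 0 ≤ ζ) (hζ : ζ ≤ 1 / 12) (hf : 2 / x ^ 2 ≤ f)
    (h : 6 * ζ * N ^ 2 ≤ 3 * s * N - 4 * s - 4 * s ^ 2 + (3.464 * x ^ 7 + 12 * x ^ 6)) :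
    (N + 1) / 2 * (1 - √(1 - 8 * ζ)) -
      (N + 1) / 2 * √(8 * f + (16 * N + 8) / (N + 1) ^ 2 * (ζ - f)) ≤ s := by
  by_contra! hcon
  have hN0 : 0 < N + 1 := by rw [← hN]; positivity
  set x0 := 1 - 8 * ζ with hx0
  set y := 8 * f + (16 * N + 8) / (N + 1) ^ 2 * (ζ - f) with hy
  have hyN : y * (N + 1) ^ 2 = 8 * f * N ^ 2 + (16 * N + 8) * ζ := by
    rw [hy]; field_simp; ring
  have hfN : 16 * x ^ 6 ≤ 8 * f * N ^ 2 := by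
    have : 2 ≤ f * x ^ 2 := by rwa [div_le_iff₀ (by positivity)] at hf
    have e : 8 * f * N ^ 2 = 8 * (f * x ^ 2) * x ^ 6 := by rw [← hN]; ring
    rw [e]; gcongr; linarith
  have hNx : 0 ≤ N := by rw [← hN]; positivity
  have hyN' : 16 * x ^ 6 ≤ y * (N + 1) ^ 2 := by
    rw [hyN]
    have : 0 ≤ (16 * N + 8) * ζ := by positivity
    linarith
  have hy0 : 0 ≤ y := by
    by_contra! hneg
    have : y * (N + 1) ^ 2 < 0 := mul_neg_of_neg_of_pos hneg (by positivity)
    have : 0 < 16 * x ^ 6 := by positivity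
    linarith
  have hx00 : 1 / 3 ≤ x0 := by rw [hx0]; linarith
  set p := √x0
  set q := √y
  have hp0 : 0 ≤ p := Real.sqrt_nonneg _
  have hq0 : 0 ≤ q := Real.sqrt_nonneg _
  have hp : p ^ 2 = x0 := Real.sq_sqrt (by linarith)
  have hq : q ^ 2 = y := Real.sq_sqrt hy0
  have hp1 : 0.57735 ≤ p := by
    apply Real.le_sqrt_of_sq_le
    refine le_trans ?_ hx00
    norm_num
  have hq1 : 4 * x ^ 3 ≤ q * (N + 1) := by
    refine le_of_sq_le_sq ?_ (by positivity)
    have e : (4 * x ^ 3) ^ 2 = 16 * x ^ 6 := by ring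
    rwa [mul_pow q, hq, e]
  have h1 : (N + 1) * (p + q) < (N + 1) - 2 * s := by linarith
  have h2 : ((N + 1) * (p + q)) ^ 2 < ((N + 1) - 2 * s) ^ 2 :=
    pow_lt_pow_left₀ h1 (by positivity) two_ne_zero
  have h3 : ((N + 1) * (p + q)) ^ 2 =
      (N + 1) ^ 2 * x0 + y * (N + 1) ^ 2 + 2 * (p * (q * (N + 1)) * (N + 1)) := by
    rw [← hp, ← hq]; ring
  have h4 : 0.57735 * (4 * x ^ 3) * x ^ 4 ≤ p * (q * (N + 1)) * (N + 1) := by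
    have : x ^ 4 ≤ N + 1 := by rw [hN]; linarith
    gcongr
  have h5 : (0.57735 : ℝ) * (4 * x ^ 3) * x ^ 4 = 2.3094 * x ^ 7 := by ring
  rw [h5] at h4
  have h6 : 0 < x ^ 7 := by positivity
  rw [h3, hyN, hx0] at h2
  nlinarith

/-- A permutation whose cycles have lengths `a`, `b` and `c`. -/
def HasThreeCycles {α : Type*} [Fintype α] (g : Equiv.Perm α) (a b c : ℕ) : Prop :=
  ∃ A B C : Finset α, (#A = a ∧ #B = b ∧ #C = c) ∧ g.IsCycleOn (A : Set α) ∧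
    g.IsCycleOn (B : Set α) ∧ g.IsCycleOn (C : Set α) ∧ Disjoint A B ∧ Disjoint A C ∧
    Disjoint B C ∧ ∀ z, z ∈ A ∨ z ∈ B ∨ z ∈ C

lemma HasThreeCycles.conj {α : Type*} [Fintype α] {g : Equiv.Perm α} {a b c : ℕ}
    (h : HasThreeCycles g a b c) (x : Equiv.Perm α) : HasThreeCycles (x * g * x⁻¹) a b c := by
  obtain ⟨A, B, C, ⟨h1, h2, h3⟩, hA, hB, hC, hAB, hAC, hBC, hU⟩ := h
  refine ⟨A.map x.toEmbedding, B.map x.toEmbedding, C.map x.toEmbedding,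
    ⟨by rwa [card_map], by rwa [card_map], by rwa [card_map]⟩, ?_, ?_, ?_,
    (disjoint_map _).2 hAB, (disjoint_map _).2 hAC, (disjoint_map _).2 hBC, fun z => ?_⟩
  · rw [coe_map]; exact hA.conj
  · rw [coe_map]; exact hB.conj
  · rw [coe_map]; exact hC.conj
  · simpa [mem_map_equiv] using hU (x.symm z)

lemma isCycleOn_finRotate (k : ℕ) : (finRotate k).IsCycleOn Set.univ := by
  rcases lt_or_ge k 2 with h | h
  · have : Subsingleton (Fin k) := Fin.subsingleton_iff_le_one.2 (by omega)
    exact Equiv.Perm.isCycleOn_of_subsingleton _ _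
  · have h1 := (isCycle_finRotate_of_le h).isCycleOn
    have h2 : {x | finRotate k x ≠ x} = Set.univ := by
      rw [← Equiv.Perm.coe_support_eq_set_support, support_finRotate_of_le h, coe_univ]
    rwa [h2] at h1

lemma isCycleOn_map_of_semiconj {α β : Type*} [Fintype β] {h : Equiv.Perm β}
    (hh : h.IsCycleOn Set.univ) {g : Equiv.Perm α} (f : β ↪ α) (hf : ∀ y, g (f y) = f (h y)) :
    g.IsCycleOn (univ.map f : Set α) := by
  have hpow : ∀ (i : ℕ) y, (g ^ i) (f y) = f ((h ^ i) y) := by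
    intro i
    induction i with
    | zero => intro y; rfl
    | succ i ih => intro y; rw [pow_succ, pow_succ, Equiv.Perm.mul_apply, hf, ih]; rfl
  rw [coe_map, coe_univ, Set.image_univ]
  refine ⟨⟨?_, g.injective.injOn, ?_⟩, ?_⟩
  · rintro _ ⟨y, rfl⟩
    exact ⟨h y, (hf y).symm⟩
  · rintro _ ⟨y, rfl⟩
    exact ⟨f (h.symm y), ⟨_, rfl⟩, by rw [hf, Equiv.apply_symm_apply]⟩
  · rintro _ ⟨y, rfl⟩ _ ⟨z, rfl⟩
    obtain ⟨i, hi⟩ := hh.exists_pow_eq' Set.finite_univ (Set.mem_univ y) (Set.mem_univ z)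
    exact ⟨i, by rw [zpow_natCast, hpow, hi]⟩

lemma exists_hasThreeCycles {n a b c : ℕ} (ha : 0 < a) (hb : 0 < b) (hc : 0 < c)
    (hn : a + b + c = n) :
    ∃ g : Equiv.Perm (Fin n), HasThreeCycles g a b c ∧ Equiv.Perm.sign g = (-1) ^ (n + 1) := by
  have hcard : Fintype.card (Fin a ⊕ Fin b ⊕ Fin c) = n := by simp; omega
  set e := Fintype.equivFinOfCardEq hcard
  set p : Equiv.Perm (Fin a ⊕ Fin b ⊕ Fin c) :=
    (finRotate a).sumCongr ((finRotate b).sumCongr (finRotate c)) with hp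
  have hpe : ∀ y, e.permCongr p (e y) = e (p y) := fun y => by simp [Equiv.permCongr_apply]
  refine ⟨e.permCongr p, ⟨univ.map (Function.Embedding.inl.trans e.toEmbedding),
    univ.map ((Function.Embedding.inl.trans Function.Embedding.inr).trans e.toEmbedding),
    univ.map ((Function.Embedding.inr.trans Function.Embedding.inr).trans e.toEmbedding),
    ⟨by simp, by simp, by simp⟩, ?_, ?_, ?_, ?_, ?_, ?_, ?_⟩, ?_⟩
  · exact isCycleOn_map_of_semiconj (isCycleOn_finRotate a) _ fun y => hpe _
  · exact isCycleOn_map_of_semiconj (isCycleOn_finRotate b) _ fun y => hpe _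
  · exact isCycleOn_map_of_semiconj (isCycleOn_finRotate c) _ fun y => hpe _
  · simp [Finset.disjoint_left]
  · simp [Finset.disjoint_left]
  · simp [Finset.disjoint_left]
  · intro z
    obtain ⟨y, rfl⟩ := e.surjective z
    rcases y with y | y | y <;> simp
  · rw [Equiv.Perm.sign_permCongr, hp, Equiv.Perm.sign_sumCongr, Equiv.Perm.sign_sumCongr,
      sign_finRotate, sign_finRotate, sign_finRotate, ← pow_add, ← pow_add]
    have : n + 1 = (a - 1 + (b - 1 + (c - 1))) + 2 * 2 := by omega
    rw [this, pow_add _ _ (2 * 2), pow_mul]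
    simp

lemma zeta2_nonneg (n : ℕ) : 0 ≤ zeta2 n := by
  refine mul_nonneg (by norm_num) (prod_nonneg fun p hp => ?_)
  have : (1 : ℝ) ≤ p := by exact_mod_cast (Nat.prime_of_mem_primeFactors hp).one_le
  have : 1 / (p : ℝ) ^ 2 ≤ 1 := (div_le_one (by positivity)).2 (one_le_pow₀ this)
  linarith

lemma zeta2_le (n : ℕ) : zeta2 n ≤ 1 / 12 := by
  have : ∏ p ∈ n.primeFactors, (1 - 1 / (p : ℝ) ^ 2) ≤ 1 := by
    refine prod_le_one (fun p hp => ?_) fun p hp => ?_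
    · have : (1 : ℝ) ≤ p := by exact_mod_cast (Nat.prime_of_mem_primeFactors hp).one_le
      have : 1 / (p : ℝ) ^ 2 ≤ 1 := (div_le_one (by positivity)).2 (one_le_pow₀ this)
      linarith
    · have : 0 ≤ 1 / (p : ℝ) ^ 2 := by positivity
      linarith
  rw [zeta2]
  linarith

lemma le_fAux {n : ℕ} (hn : 1 ≤ n) {x : ℝ} (hxn : x ^ 4 = n) :
    2 / x ^ 2 ≤ fAux n := by
  have h1 : (n : ℝ) ^ ((1 : ℝ) / 2) = x ^ 2 := by
    rw [← Real.sqrt_eq_rpow, ← hxn, Real.sqrt_eq_iff_mul_self_eq (by positivity) (by positivity)]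
    ring
  have hn' : (1 : ℝ) ≤ n := by exact_mod_cast hn
  have h2 : 0 ≤ Real.logb 2 n := Real.logb_nonneg (by norm_num) hn'
  have h3 : 0 ≤ Real.logb 3 n := Real.logb_nonneg (by norm_num) hn'
  rw [fAux, h1]
  split_ifs <;> exact le_add_of_nonneg_left (by positivity)

/-- For small `n` the lower bound is not positive. -/
lemma lower_bound_nonpos {N ζ f x : ℝ} (hN : x ^ 4 = N) (hx : 1 ≤ x) (hx9 : x ≤ 9)
    (hζ0 : 0 ≤ ζ) (hζ : ζ ≤ 1 / 12) (hf : 2 / x ^ 2 ≤ f) :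
    (N + 1) / 2 * (1 - √(1 - 8 * ζ)) -
      (N + 1) / 2 * √(8 * f + (16 * N + 8) / (N + 1) ^ 2 * (ζ - f)) ≤ 0 := by
  have hNx : 0 ≤ N := by rw [← hN]; positivity
  have hN0 : 0 < N + 1 := by linarith
  set y := 8 * f + (16 * N + 8) / (N + 1) ^ 2 * (ζ - f) with hy
  have hyN : y * (N + 1) ^ 2 = 8 * f * N ^ 2 + (16 * N + 8) * ζ := by
    rw [hy]; field_simp; ring
  have hfN : 16 * x ^ 6 ≤ 8 * f * N ^ 2 := by
    have : 2 ≤ f * x ^ 2 := by rwa [div_le_iff₀ (by positivity)] at hf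
    have e : 8 * f * N ^ 2 = 8 * (f * x ^ 2) * x ^ 6 := by rw [← hN]; ring
    rw [e]; gcongr; linarith
  have hp1 : 0.57735 ≤ √(1 - 8 * ζ) := by
    apply Real.le_sqrt_of_sq_le
    norm_num
    linarith
  have hkey : 0.42265 * (N + 1) ≤ 4 * x ^ 3 := by
    rw [← hN]
    have : 0 ≤ x ^ 3 * (9 - x) := mul_nonneg (by positivity) (by linarith)
    have : 1 ≤ x ^ 3 := one_le_pow₀ hx
    nlinarith
  have hq : 0.42265 ≤ √y := by
    apply Real.le_sqrt_of_sq_le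
    have h1 : (0.42265 * (N + 1)) ^ 2 ≤ (4 * x ^ 3) ^ 2 :=
      pow_le_pow_left₀ (by positivity) hkey 2
    have h2 : 0 ≤ (16 * N + 8) * ζ := by positivity
    have h3 : 0.42265 ^ 2 * (N + 1) ^ 2 ≤ y * (N + 1) ^ 2 := by
      rw [hyN, ← mul_pow]
      have e : (4 * x ^ 3) ^ 2 = 16 * x ^ 6 := by ring
      linarith
    exact le_of_mul_le_mul_right h3 (by positivity)
  rw [← mul_sub]
  apply mul_nonpos_of_nonneg_of_nonpos <;> linarith

/-- Subgroups covering all permutations with three cycles. -/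
theorem lower_bound_of_covering {n s : ℕ} (hn : 4 ≤ n) (H : Fin s → Subgroup (Equiv.Perm (Fin n)))
    (hcov : ∀ a b c, 0 < a → 0 < b → 0 < c → a + b + c = n →
      ∃ i, ¬ alternatingGroup (Fin n) ≤ H i ∧ ∃ g ∈ H i, HasThreeCycles g a b c) :
    ((n : ℝ) + 1) / 2 * (1 - √(1 - 8 * zeta2 n)) - ((n : ℝ) + 1) / 2 *
      √(8 * fAux n + (16 * (n : ℝ) + 8) / ((n : ℝ) + 1) ^ 2 * (zeta2 n - fAux n)) ≤ s := by
  classical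
  obtain ⟨x, hx0, hxn⟩ : ∃ x : ℝ, 0 ≤ x ∧ x ^ 4 = n := by
    refine ⟨√√n, Real.sqrt_nonneg _, ?_⟩
    rw [show 4 = 2 * 2 from rfl, pow_mul, Real.sq_sqrt (Real.sqrt_nonneg _),
      Real.sq_sqrt n.cast_nonneg]
  have hn4 : (4 : ℝ) ≤ n := by exact_mod_cast hn
  have hf := le_fAux (by omega) hxn
  have hζ0 := zeta2_nonneg n
  have hζ := zeta2_le n
  have hs0 : (0 : ℝ) ≤ s := s.cast_nonneg
  rcases le_total x 9 with hx9 | hx9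
  · refine (lower_bound_nonpos hxn ?_ hx9 hζ0 hζ hf).trans hs0
    by_contra! hlt
    have : x ^ 4 ≤ 1 := pow_le_one₀ hx0 hlt.le
    linarith
  rcases lt_or_ge (n : ℝ) (4 * s) with hs | hs
  · have hp1 : 0.57735 ≤ √(1 - 8 * zeta2 n) := by
      apply Real.le_sqrt_of_sq_le
      norm_num
      linarith
    have hq : 0 ≤ ((n : ℝ) + 1) / 2 *
        √(8 * fAux n + (16 * (n : ℝ) + 8) / ((n : ℝ) + 1) ^ 2 * (zeta2 n - fAux n)) := by positivity
    have : ((n : ℝ) + 1) / 2 * (1 - √(1 - 8 * zeta2 n)) ≤ ((n : ℝ) + 1) / 2 * 0.42265 := by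
      gcongr; linarith
    have : (100 : ℝ) ≤ n := by
      rw [← hxn]
      calc (100 : ℝ) ≤ 9 ^ 4 := by norm_num
        _ ≤ x ^ 4 := by gcongr
    linarith
  refine lower_bound_of_count hxn hx9 hs0 hζ0 hζ hf ?_
  set D := ⌊3 / 4 * x⌋₊
  have hD : 4 * (D : ℝ) ≤ 3 * x := by
    have : (D : ℝ) ≤ 3 / 4 * x := Nat.floor_le (by positivity)
    linarith
  have hD' : 3 * x ≤ 4 * (D + 1 : ℝ) := by
    have : 3 / 4 * x < D + 1 := Nat.lt_floor_add_one _
    linarith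
  set z : Fin n := ⟨0, by omega⟩
  set k : Fin s → ℕ := fun i => (orbit (H i) z).ncard
  set K : Finset ℕ := {j ∈ univ.image k ∪ univ.image fun i => n - k i | 0 < j ∧ j < n} with hK
  have hmem : ∀ j, j ∈ K ↔ (∃ i, k i = j ∨ n - k i = j) ∧ 0 < j ∧ j < n := by
    intro j
    simp [hK, exists_or]
  have hKs : ∀ j ∈ K, 0 < j ∧ j < n ∧ n - j ∈ K := by
    intro j hj
    obtain ⟨⟨i, hi⟩, h0, hjn⟩ := (hmem j).1 hj
    exact ⟨h0, hjn, (hmem _).2 ⟨⟨i, by omega⟩, by omega, by omega⟩⟩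
  have hKcard : #K ≤ 2 * s := by
    refine (card_filter_le _ _).trans ((card_union_le _ _).trans ?_)
    have h1 : #(univ.image k) ≤ #(univ : Finset (Fin s)) := card_image_le
    have h2 : #(univ.image fun i => n - k i) ≤ #(univ : Finset (Fin s)) := card_image_le
    rw [card_univ, Fintype.card_fin] at h1 h2
    omega
  have hcount := coprime_triples_le_of_forall_good hx9 hxn hD hD' (K := K) (by
    intro a b c habc hgood
    have hpos : ∀ m : ℕ, 2 / 5 * x ^ 3 ≤ m → 0 < m := fun m hm => by
      exact_mod_cast lt_of_lt_of_le (by positivity : (0 : ℝ) < 2 / 5 * x ^ 3) hm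
    have ha := hpos a hgood.le_fst
    have hb := hpos b hgood.le_snd
    have hc := hpos c hgood.le_trd
    obtain ⟨i, hi, g, hg, A, B, C, ⟨rfl, rfl, rfl⟩, hA, hB, hC, hAB, hAC, hBC, hU⟩ :=
      hcov a b c ha hb hc habc
    have hU' : A ∪ B ∪ C = univ := eq_univ_iff_forall.2 fun w => by
      simpa [or_assoc] using hU w
    obtain ⟨p, hp, hpk⟩ := ncard_orbit_of_three_cycles (not_isPretransitive_of_three_cycles hi hg
      hA hB hC hAB hAC hBC hU' hx9 (by rw [Fintype.card_fin]; exact hxn) hD hgood) hg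
      hA hB hC hAB hAC hBC hU' z
    rw [Fintype.card_fin] at hpk
    have hpK : p ∈ K := (hmem p).2 ⟨⟨i, by simp only [k]; omega⟩, by omega, by omega⟩
    rcases hp with rfl | rfl | rfl
    · exact Or.inl hpK
    · exact Or.inr (Or.inl hpK)
    · exact Or.inr (Or.inr hpK))
  have hU := two_mul_card_triples_mem_le hKs
  set U := #{t ∈ positiveTriples n | t.1 ∈ K ∨ t.2.1 ∈ K ∨ t.2.2 ∈ K}
  have hUr : 2 * (U : ℝ) + 2 * (#K * #K) ≤ 3 * (#K * (n - 2)) + 2 * #K := by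
    have e : ((n - 2 : ℕ) : ℝ) = n - 2 := by
      rw [Nat.cast_sub (by omega)]; norm_num
    rw [← e]
    exact_mod_cast hU
  have hKr : (#K : ℝ) ≤ 2 * s := by exact_mod_cast hKcard
  have hmono : 0 ≤ (2 * s - #K : ℝ) * (3 * n - 4 - 4 * s - 2 * #K) := by
    apply mul_nonneg <;> linarith
  nlinarith

/-- The normal covering number is attained. -/
lemma exists_normalCovering {G : Type*} [Group G] [Finite G] (hG : ¬ IsCyclic G) :
    ∃ H : Fin (normalCoveringNumber G) → Subgroup G, (∀ i, H i ≠ ⊤) ∧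
      ∀ g : G, ∃ i, ∃ x : G, x * g * x⁻¹ ∈ H i := by
  refine Nat.sInf_mem (s := {s : ℕ | ∃ H : Fin s → Subgroup G, (∀ i, H i ≠ ⊤) ∧
    ∀ g : G, ∃ i : Fin s, ∃ x : G, x * g * x⁻¹ ∈ H i}) ?_
  refine ⟨Nat.card G, fun i => Subgroup.zpowers ((Finite.equivFin G).symm i), fun i h => ?_,
    fun g => ⟨Finite.equivFin G g, 1, by simp⟩⟩
  have h' : Subgroup.zpowers ((Finite.equivFin G).symm i) = ⊤ := h
  exact hG ⟨⟨_, fun y => h' ▸ Subgroup.mem_top y⟩⟩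

lemma not_isCyclic_alternatingGroup {n : ℕ} (hn : 4 ≤ n) :
    ¬ IsCyclic (alternatingGroup (Fin n)) := by
  rw [alternatingGroup.isCyclic_iff_card_le_three, Nat.card_fin]
  omega

lemma eq_top_of_alternatingGroup_le {α : Type*} [Fintype α] [DecidableEq α]
    {H : Subgroup (Equiv.Perm α)} (h : alternatingGroup α ≤ H) {g : Equiv.Perm α} (hg : g ∈ H)
    (hs : Equiv.Perm.sign g = -1) : H = ⊤ := by
  refine eq_top_iff.2 fun σ _ => ?_
  rcases Int.units_eq_one_or (Equiv.Perm.sign σ) with h1 | h1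
  · exact h (Equiv.Perm.mem_alternatingGroup.2 h1)
  · rw [← mul_inv_cancel_right σ g]
    refine H.mul_mem (h (Equiv.Perm.mem_alternatingGroup.2 ?_)) (H.inv_mem hg)
    rw [map_mul, h1, hs]
    decide

theorem lower_bound_perm {n : ℕ} (hn : 4 ≤ n) (he : Even n) :
    ((n : ℝ) + 1) / 2 * (1 - √(1 - 8 * zeta2 n)) - ((n : ℝ) + 1) / 2 *
      √(8 * fAux n + (16 * (n : ℝ) + 8) / ((n : ℝ) + 1) ^ 2 * (zeta2 n - fAux n)) ≤
      normalCoveringNumber (Equiv.Perm (Fin n)) := by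
  obtain ⟨H, hH, hcov⟩ := exists_normalCovering (G := Equiv.Perm (Fin n)) fun _ =>
    not_isCyclic_alternatingGroup hn inferInstance
  refine lower_bound_of_covering hn H fun a b c ha hb hc habc => ?_
  obtain ⟨g, hg, hs⟩ := exists_hasThreeCycles ha hb hc habc
  obtain ⟨i, x, hx⟩ := hcov g
  refine ⟨i, fun hle => hH i (eq_top_of_alternatingGroup_le hle hx ?_), _, hx, hg.conj x⟩
  rw [map_mul, map_mul, mul_right_comm, ← map_mul, mul_inv_cancel, map_one, one_mul, hs,
    he.add_one.neg_one_pow]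

theorem lower_bound_alternatingGroup {n : ℕ} (hn : 4 ≤ n) (ho : Odd n) :
    ((n : ℝ) + 1) / 2 * (1 - √(1 - 8 * zeta2 n)) - ((n : ℝ) + 1) / 2 *
      √(8 * fAux n + (16 * (n : ℝ) + 8) / ((n : ℝ) + 1) ^ 2 * (zeta2 n - fAux n)) ≤
      normalCoveringNumber (alternatingGroup (Fin n)) := by
  obtain ⟨H, hH, hcov⟩ := exists_normalCovering (not_isCyclic_alternatingGroup hn)
  refine lower_bound_of_covering hn (fun i => (H i).map (alternatingGroup (Fin n)).subtype)
    fun a b c ha hb hc habc => ?_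
  obtain ⟨g, hg, hs⟩ := exists_hasThreeCycles ha hb hc habc
  have hgA : g ∈ alternatingGroup (Fin n) :=
    Equiv.Perm.mem_alternatingGroup.2 (hs.trans ho.add_one.neg_one_pow)
  obtain ⟨i, x, hx⟩ := hcov ⟨g, hgA⟩
  refine ⟨i, fun hle => hH i (eq_top_iff.2 fun y _ => ?_), _,
    Subgroup.mem_map_of_mem _ hx, hg.conj (x : Equiv.Perm (Fin n))⟩
  obtain ⟨y', hy', e⟩ := hle y.2
  rwa [← Subtype.ext e]

end NormalCovering

theorem gamma_lower_bound_corollary (n : ℕ) (hn : 4 ≤ n) :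
    (Even n →
      (normalCoveringNumber (Equiv.Perm (Fin n)) : ℝ) ≥
        ((n : ℝ) + 1) / 2 * (1 - Real.sqrt (1 - 8 * zeta2 n)) -
          ((n : ℝ) + 1) / 2 *
            Real.sqrt (8 * fAux n +
              (16 * (n : ℝ) + 8) / ((n : ℝ) + 1) ^ 2 * (zeta2 n - fAux n))) ∧
    (Odd n →
      (normalCoveringNumber (alternatingGroup (Fin n)) : ℝ) ≥
        ((n : ℝ) + 1) / 2 * (1 - Real.sqrt (1 - 8 * zeta2 n)) -
          ((n : ℝ) + 1) / 2 *
            Real.sqrt (8 * fAux n +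
              (16 * (n : ℝ) + 8) / ((n : ℝ) + 1) ^ 2 * (zeta2 n - fAux n))) := by
  exact ⟨fun h => NormalCovering.lower_bound_perm hn h,
    fun h => NormalCovering.lower_bound_alternatingGroup hn h⟩
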